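/- arXiv:math/0610988 — 2 statements merged into one kernel-verified Lean document; each statement's English description precedes it below -/
import Mathlib

section
/- Let E be a Borel equivalence relation on a Polish space such that E is Borel reducible to E₂. Then either E₂ is Borel reducible to E (so that E is Borel bireducible with E₂), or E is essentially countable. -/
open MeasureTheory

/-- Borel reducibility: a Borel-measurable map `θ` with `E x x' ↔ F (θ x) (θ x')`. -/
def BorelReducible {X Y : Type*} [TopologicalSpace X] [TopologicalSpace Y]
    (E : X → X → Prop) (F : Y → Y → Prop) : Prop :=
  ∃ θ : X → Y, @Measurable X Y (borel X) (borel Y) θ ∧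
    ∀ x x' : X, E x x' ↔ F (θ x) (θ x')

/-- `E₂`: identifying subsets of `ℕ` with their characteristic functions,
`x E₂ y` iff `∑_{n ∈ x Δ y} 1/(n+1) < ∞`. -/
def E2 (x y : ℕ → Bool) : Prop :=
  Summable (fun n : ℕ => if x n = y n then (0 : ℝ) else 1 / (n + 1))

/-- `E` is essentially countable: `E` is Borel reducible to some Borel equivalence
relation on a Polish space all of whose classes are countable. -/
def EssentiallyCountable {X : Type*} [TopologicalSpace X] (E : X → X → Prop) : Prop :=
  ∃ (Y : Type) (_ : TopologicalSpace Y) (F : Y → Y → Prop),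
    PolishSpace Y ∧ Equivalence F ∧
    MeasurableSet[borel (Y × Y)] {p : Y × Y | F p.1 p.2} ∧
    (∀ y : Y, {z : Y | F y z}.Countable) ∧
    BorelReducible E F

namespace FourthDichotomy

open scoped ENNReal
open Set PiNat Filter Topology

/-! ### The metric of the summable ideal -/

/-- The contribution of the coordinate `k` to the distance between `a` and `b`. -/
noncomputable def disagree (a b : ℕ → Bool) (k : ℕ) : ℝ≥0∞ :=
  if a k = b k then 0 else ENNReal.ofReal (1 / (k + 1))

/-- The mass of the part of `a Δ b` beyond `m`. -/
noncomputable def tailDist (m : ℕ) (a b : ℕ → Bool) : ℝ≥0∞ := ∑' k, disagree a b (k + m)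

/-- The mass of `a Δ b`. -/
noncomputable def summDist (a b : ℕ → Bool) : ℝ≥0∞ := ∑' k, disagree a b k

/-- The mass of the part of `a Δ b` in `[m, m')`. -/
noncomputable def blockDist (m m' : ℕ) (a b : ℕ → Bool) : ℝ≥0∞ :=
  ∑ k ∈ Finset.Ico m m', disagree a b k

theorem disagree_self (a : ℕ → Bool) (k : ℕ) : disagree a a k = 0 := by simp [disagree]

theorem disagree_comm (a b : ℕ → Bool) (k : ℕ) : disagree a b k = disagree b a k := by
  simp [disagree, eq_comm]

theorem disagree_triangle (a b c : ℕ → Bool) (k : ℕ) :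
    disagree a c k ≤ disagree a b k + disagree b c k := by
  unfold disagree
  by_cases h : a k = b k
  · simp [h]
  · by_cases h' : a k = c k
    · simp [h']
    · simp [h, h']

theorem disagree_ne_top (a b : ℕ → Bool) (k : ℕ) : disagree a b k ≠ ⊤ := by
  unfold disagree; split_ifs <;> simp

theorem disagree_congr {a b a' b' : ℕ → Bool} {k : ℕ} (ha : a k = a' k) (hb : b k = b' k) :
    disagree a b k = disagree a' b' k := by
  simp [disagree, ha, hb]

theorem E2_iff (a b : ℕ → Bool) : E2 a b ↔ summDist a b ≠ ⊤ := by
  have hfun : (fun n : ℕ => if a n = b n then (0 : ℝ) else 1 / (n + 1)) =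
      fun n => (disagree a b n).toReal := by
    funext n
    unfold disagree
    split_ifs
    · simp
    · rw [ENNReal.toReal_ofReal (by positivity)]
  unfold E2 summDist
  rw [hfun]
  refine ⟨fun h => ?_, ENNReal.summable_toReal⟩
  have := h.tsum_ofReal_ne_top
  simpa [ENNReal.ofReal_toReal (disagree_ne_top a b _)] using this

theorem summDist_self (a : ℕ → Bool) : summDist a a = 0 := by simp [summDist, disagree_self]

theorem summDist_comm (a b : ℕ → Bool) : summDist a b = summDist b a := by
  simp only [summDist, disagree_comm a b]

theorem summDist_triangle (a b c : ℕ → Bool) :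
    summDist a c ≤ summDist a b + summDist b c := by
  unfold summDist
  rw [← ENNReal.tsum_add]
  exact ENNReal.tsum_le_tsum (disagree_triangle a b c)

theorem E2_equivalence : Equivalence E2 where
  refl a := by simp [E2_iff, summDist_self]
  symm {a b} h := by rwa [E2_iff, summDist_comm, ← E2_iff]
  trans {a b c} h h' := by
    rw [E2_iff] at *
    exact ne_top_of_le_ne_top (ENNReal.add_ne_top.2 ⟨h, h'⟩) (summDist_triangle a b c)

theorem tailDist_comm (m : ℕ) (a b : ℕ → Bool) : tailDist m a b = tailDist m b a := by
  simp only [tailDist, disagree_comm a b]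

theorem tailDist_self (m : ℕ) (a : ℕ → Bool) : tailDist m a a = 0 := by
  simp [tailDist, disagree_self]

theorem tailDist_triangle (m : ℕ) (a b c : ℕ → Bool) :
    tailDist m a c ≤ tailDist m a b + tailDist m b c := by
  unfold tailDist
  rw [← ENNReal.tsum_add]
  exact ENNReal.tsum_le_tsum fun k => disagree_triangle a b c _

theorem blockDist_comm (m m' : ℕ) (a b : ℕ → Bool) : blockDist m m' a b = blockDist m m' b a := by
  simp only [blockDist, disagree_comm a b]

theorem blockDist_triangle (m m' : ℕ) (a b c : ℕ → Bool) :
    blockDist m m' a c ≤ blockDist m m' a b + blockDist m m' b c := by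
  unfold blockDist
  rw [← Finset.sum_add_distrib]
  exact Finset.sum_le_sum fun k _ => disagree_triangle a b c k

theorem blockDist_congr {m m' : ℕ} {a b a' b' : ℕ → Bool} (ha : ∀ k < m', a k = a' k)
    (hb : ∀ k < m', b k = b' k) : blockDist m m' a b = blockDist m m' a' b' :=
  Finset.sum_congr rfl fun k hk =>
    disagree_congr (ha k (Finset.mem_Ico.1 hk).2) (hb k (Finset.mem_Ico.1 hk).2)

theorem blockDist_eq_zero {m : ℕ} {a b : ℕ → Bool} (h : ∀ k < m, a k = b k) :
    blockDist 0 m a b = 0 := by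
  rw [blockDist_congr h (fun _ _ => rfl)]
  simp [blockDist, disagree_self]

theorem blockDist_add_tailDist {m m' : ℕ} (h : m ≤ m') (a b : ℕ → Bool) :
    blockDist m m' a b + tailDist m' a b = tailDist m a b := by
  obtain ⟨l, rfl⟩ := Nat.exists_eq_add_of_le h
  unfold blockDist tailDist
  rw [Finset.sum_Ico_eq_sum_range, Nat.add_sub_cancel_left]
  have := (ENNReal.summable (f := fun k => disagree a b (k + l + m))).sum_add_tsum_nat_add'
    (f := fun k => disagree a b (k + m)) (k := l)
  rw [← this]
  congr 1
  · simp only [add_comm m]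
  · simp only [add_assoc, add_comm l]

theorem tailDist_zero (a b : ℕ → Bool) : tailDist 0 a b = summDist a b := rfl

theorem blockDist_le_tailDist {m m' : ℕ} (h : m ≤ m') (a b : ℕ → Bool) :
    blockDist m m' a b ≤ tailDist m a b := by
  rw [← blockDist_add_tailDist h]; exact le_self_add

theorem blockDist_ne_top (m m' : ℕ) (a b : ℕ → Bool) : blockDist m m' a b ≠ ⊤ :=
  ENNReal.sum_ne_top.2 fun k _ => disagree_ne_top a b k

theorem summDist_ne_top_iff (m : ℕ) (a b : ℕ → Bool) :
    summDist a b ≠ ⊤ ↔ tailDist m a b ≠ ⊤ := by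
  rw [← tailDist_zero, ← blockDist_add_tailDist (Nat.zero_le m), ENNReal.add_ne_top]
  simp [blockDist_ne_top]

theorem tendsto_tailDist {a b : ℕ → Bool} (h : summDist a b ≠ ⊤) :
    Tendsto (fun m => tailDist m a b) atTop (𝓝 0) :=
  ENNReal.tendsto_sum_nat_add _ h

theorem summDist_eq_iSup {m : ℕ → ℕ} (hm : Tendsto m atTop atTop) (a b : ℕ → Bool) :
    summDist a b = ⨆ n, blockDist 0 (m n) a b := by
  simp only [summDist, blockDist, ENNReal.tsum_eq_iSup_nat' hm, ← Finset.range_eq_Ico]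

theorem summDist_eq_tsum_blockDist {m : ℕ → ℕ} (h0 : m 0 = 0) (hm : StrictMono m)
    (a b : ℕ → Bool) : summDist a b = ∑' n, blockDist (m n) (m (n + 1)) a b := by
  rw [summDist_eq_iSup hm.tendsto_atTop, ENNReal.tsum_eq_iSup_nat]
  congr 1
  funext n
  induction n with
  | zero => simp [h0, blockDist]
  | succ n ih =>
    rw [Finset.sum_range_succ, ← ih]
    exact (Finset.sum_Ico_consecutive _ (Nat.zero_le _) (hm.monotone n.le_succ)).symm

theorem measurable_disagree (k : ℕ) :
    Measurable fun p : (ℕ → Bool) × (ℕ → Bool) => disagree p.1 p.2 k := by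
  unfold disagree
  refine Measurable.ite ?_ measurable_const measurable_const
  exact measurableSet_eq_fun ((measurable_pi_apply k).comp measurable_fst)
    ((measurable_pi_apply k).comp measurable_snd)

theorem measurable_tailDist (m : ℕ) :
    Measurable fun p : (ℕ → Bool) × (ℕ → Bool) => tailDist m p.1 p.2 :=
  Measurable.tsum fun k => measurable_disagree (k + m)

theorem measurable_summDist :
    Measurable fun p : (ℕ → Bool) × (ℕ → Bool) => summDist p.1 p.2 :=
  measurable_tailDist 0

theorem isClopen_res_mem (n : ℕ) (S : Set (List Bool)) :
    IsClopen {a : ℕ → Bool | res a n ∈ S} := by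
  induction n generalizing S with
  | zero => by_cases h : [] ∈ S <;> simp [h, isClopen_univ, isClopen_empty]
  | succ n ih =>
    have hb : ∀ b : Bool, IsClopen {a : ℕ → Bool | a n = b} := fun b =>
      (isClopen_discrete {b}).preimage (continuous_apply n)
    have : {a : ℕ → Bool | res a (n + 1) ∈ S} =
        ({a | a n = true} ∩ {a | res a n ∈ {t | true :: t ∈ S}}) ∪
        ({a | a n = false} ∩ {a | res a n ∈ {t | false :: t ∈ S}}) := by
      ext a
      cases h : a n <;> simp [h]
    rw [this]
    exact ((hb _).inter (ih _)).union ((hb _).inter (ih _))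

/-! ### Separation of analytic sets -/

section Separation

theorem _root_.MeasureTheory.AnalyticSet.inter {X : Type*} [TopologicalSpace X] [T2Space X]
    {s t : Set X} (hs : AnalyticSet s)
    (ht : AnalyticSet t) : AnalyticSet (s ∩ t) := by
  rw [inter_eq_iInter]
  exact AnalyticSet.iInter fun b => by cases b <;> assumption

theorem _root_.MeasureTheory.AnalyticSet.union {X : Type*} [TopologicalSpace X]
    {s t : Set X} (hs : AnalyticSet s)
    (ht : AnalyticSet t) : AnalyticSet (s ∪ t) := by
  rw [union_eq_iUnion]
  exact AnalyticSet.iUnion fun b => by cases b <;> assumption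

variable {X : Type*} [TopologicalSpace X] [PolishSpace X] [MeasurableSpace X] [BorelSpace X]

theorem analyticSet_exists_rel {A : Set X} (hA : AnalyticSet A) {D : Set (X × X)}
    (hD : MeasurableSet D) : AnalyticSet {x | ∃ y ∈ A, (x, y) ∈ D} := by
  have : {x | ∃ y ∈ A, (x, y) ∈ D} = Prod.fst '' (D ∩ Prod.snd ⁻¹' A) := by
    ext x; simp [and_comm]
  rw [this]
  exact (hD.analyticSet.inter (hA.preimage continuous_snd)).image_of_continuous continuous_fst

/-- An analytic independent set of a symmetric Borel graph extends to a Borel one. -/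
theorem exists_measurable_independent {A : Set X} (hA : AnalyticSet A) {D : Set (X × X)}
    (hD : MeasurableSet D) (hsymm : ∀ x y, (x, y) ∈ D → (y, x) ∈ D)
    (hind : ∀ x ∈ A, ∀ y ∈ A, (x, y) ∉ D) :
    ∃ B, A ⊆ B ∧ MeasurableSet B ∧ ∀ x ∈ B, ∀ y ∈ B, (x, y) ∉ D := by
  obtain ⟨C, hAC, hC, hCm⟩ := hA.measurablySeparable (analyticSet_exists_rel hA hD)
    (disjoint_left.2 fun x hx ⟨y, hy, h⟩ => hind x hx y hy h)
  obtain ⟨C', hAC', hC', hCm'⟩ := hA.measurablySeparable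
    (analyticSet_exists_rel hCm.analyticSet hD)
    (disjoint_left.2 fun x hx ⟨y, hy, h⟩ => disjoint_left.1 hC ⟨x, hx, hsymm _ _ h⟩ hy)
  exact ⟨C ∩ C', subset_inter hAC hAC', hCm.inter hCm', fun x hx y hy h =>
    disjoint_left.1 hC' ⟨y, hy.1, h⟩ hx.2⟩

/-- Disjoint analytic sets, one of them closed under a Borel relation, are separated by
a Borel set closed under the converse relation. -/
theorem exists_measurable_invariant {A₀ A₁ : Set X} (hA₀ : AnalyticSet A₀) (hA₁ : AnalyticSet A₁)
    (hdisj : Disjoint A₀ A₁) {F : Set (X × X)} (hF : MeasurableSet F)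
    (hinv : ∀ x y, (x, y) ∈ F → x ∈ A₁ → y ∈ A₁) :
    ∃ V, A₀ ⊆ V ∧ MeasurableSet V ∧ Disjoint V A₁ ∧ ∀ x y, (x, y) ∈ F → y ∈ V → x ∈ V := by
  have step : ∀ C : Set X, MeasurableSet C ∧ Disjoint C A₁ → ∃ C' : Set X,
      (MeasurableSet C' ∧ Disjoint C' A₁) ∧ C ⊆ C' ∧ ∀ x y, (x, y) ∈ F → y ∈ C → x ∈ C' := by
    rintro C ⟨hC, hCA⟩
    obtain ⟨C', h1, h2, h3⟩ := (hC.analyticSet.union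
      (analyticSet_exists_rel hC.analyticSet hF)).measurablySeparable hA₁ (by
        refine disjoint_union_left.2 ⟨hCA, disjoint_left.2 ?_⟩
        rintro x ⟨y, hy, h⟩ hx
        exact disjoint_left.1 hCA hy (hinv _ _ h hx))
    exact ⟨C', ⟨h3, h2.symm⟩, subset_union_left.trans h1, fun x y h hy => h1 (Or.inr ⟨y, hy, h⟩)⟩
  choose! next hnext hsub hcl using step
  obtain ⟨C₀, h1, h2, h3⟩ := hA₀.measurablySeparable hA₁ hdisj
  let C : ℕ → Set X := fun n => next^[n] C₀
  have hsucc : ∀ n, C (n + 1) = next (C n) := fun n => Function.iterate_succ_apply' _ _ _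
  have hC : ∀ n, MeasurableSet (C n) ∧ Disjoint (C n) A₁ := by
    intro n
    induction n with
    | zero => exact ⟨h3, h2.symm⟩
    | succ n ih => rw [hsucc]; exact hnext _ ih
  refine ⟨⋃ n, C n, h1.trans (subset_iUnion C 0), .iUnion fun n => (hC n).1,
    disjoint_iUnion_left.2 fun n => (hC n).2, fun x y h hy => ?_⟩
  obtain ⟨n, hn⟩ := mem_iUnion.1 hy
  exact mem_iUnion.2 ⟨n + 1, by rw [hsucc]; exact hcl _ (hC n) _ _ h hn⟩

end Separation

/-! ### Borel selection of branches through binary trees -/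

/-- `s` has an extension of `N` further levels all of whose initial segments lie in `T`. Lists are
read backwards, as in `PiNat.res`. -/
def Extends (T : Set (List Bool)) (N : ℕ) (s : List Bool) : Prop :=
  ∃ t : List Bool, t.length = N ∧ ∀ u, u <:+ t ++ s → u ∈ T

theorem Extends.of_succ {T : Set (List Bool)} {N : ℕ} {s : List Bool}
    (h : Extends T (N + 1) s) : Extends T N s := by
  obtain ⟨t, ht, h⟩ := h
  obtain ⟨b, t, rfl⟩ := List.exists_cons_of_length_eq_add_one ht
  exact ⟨t, by simpa using ht, fun u hu => h u (hu.trans (by simp))⟩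

theorem Extends.of_le {T : Set (List Bool)} {N M : ℕ} {s : List Bool} (hNM : N ≤ M)
    (h : Extends T M s) : Extends T N s := by
  induction hNM with
  | refl => exact h
  | step _ ih => exact ih h.of_succ

theorem Extends.exists_cons {T : Set (List Bool)} {N : ℕ} {s : List Bool}
    (h : Extends T (N + 1) s) : ∃ b, Extends T N (b :: s) := by
  obtain ⟨t, ht, h⟩ := h
  have hne : t ≠ [] := by rintro rfl; simp at ht
  refine ⟨t.getLast hne, t.dropLast, by simp [ht], fun u hu => h u ?_⟩
  rwa [← List.singleton_append, ← List.append_assoc, List.dropLast_append_getLast hne] at hu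

open Classical in
/-- The initial segment of length `n` of the greedily chosen branch of `T`. -/
noncomputable def branchPrefix (T : Set (List Bool)) : ℕ → List Bool
  | 0 => []
  | n + 1 => decide (∀ N, Extends T N (true :: branchPrefix T n)) :: branchPrefix T n

open Classical in
/-- The greedily chosen branch of `T`. -/
noncomputable def branch (T : Set (List Bool)) (n : ℕ) : Bool :=
  decide (∀ N, Extends T N (true :: branchPrefix T n))

theorem res_branch (T : Set (List Bool)) (n : ℕ) : res (branch T) n = branchPrefix T n := by
  induction n with
  | zero => rfl
  | succ n ih => rw [res_succ, ih]; rfl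

open Classical in
theorem res_branch_mem {T : Set (List Bool)} {z : ℕ → Bool} (hz : ∀ n, res z n ∈ T) (n : ℕ) :
    res (branch T) n ∈ T := by
  have hsuff : ∀ k u, u <:+ res z k → u ∈ T := by
    intro k
    induction k with
    | zero => intro u hu; rw [res_zero, List.suffix_nil] at hu; exact hu ▸ hz 0
    | succ k ih =>
      intro u hu
      rw [res_succ, List.suffix_cons_iff] at hu
      rcases hu with rfl | hu
      · exact hz (k + 1)
      · exact ih u hu
  have key : ∀ N, Extends T N (branchPrefix T n) := by
    induction n with
    | zero => exact fun N => ⟨res z N, by simp, fun u hu => hsuff N u (by simpa [branchPrefix] using hu)⟩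
    | succ n ih =>
      unfold branchPrefix
      by_cases h : ∀ N, Extends T N (true :: branchPrefix T n)
      · rw [decide_eq_true h]
        exact h
      · rw [decide_eq_false h]
        obtain ⟨M, hM⟩ := not_forall.1 h
        intro N
        obtain ⟨b, hb⟩ := (ih (max M N + 1)).exists_cons
        cases b
        · exact hb.of_le (le_max_right _ _)
        · exact absurd (hb.of_le (le_max_left _ _)) hM
  obtain ⟨t, ht, h⟩ := key 0
  rw [List.length_eq_zero_iff] at ht
  subst ht
  rw [res_branch]
  exact h _ (List.suffix_refl _)

theorem measurableSet_extends (s : List Bool) :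
    MeasurableSet {T : Set (List Bool) | ∀ N, Extends T N s} := by
  have : {T : Set (List Bool) | ∀ N, Extends T N s} =
      ⋂ N : ℕ, ⋃ t ∈ {t : List Bool | t.length = N}, ⋂ u ∈ {u | u <:+ t ++ s}, {T | u ∈ T} := by
    ext T; simp [Extends]
  rw [this]
  refine .iInter fun N => .biUnion (to_countable _) fun t _ => .biInter (to_countable _) fun u _ => ?_
  exact measurableSet_setOfPred.2 (measurable_set_mem u)

open Classical in
theorem measurableSet_branchPrefix (n : ℕ) (s : List Bool) :
    MeasurableSet {T : Set (List Bool) | branchPrefix T n = s} := by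
  induction n generalizing s with
  | zero => simp [branchPrefix]
  | succ n ih =>
    cases s with
    | nil => simp [branchPrefix]
    | cons b s =>
      have : {T : Set (List Bool) | branchPrefix T (n + 1) = b :: s} =
          {T | branchPrefix T n = s} ∩ {T | (∀ N, Extends T N (true :: s)) ↔ b = true} := by
        ext T
        simp only [branchPrefix, List.cons.injEq, mem_ofPred_eq, mem_inter_iff]
        constructor
        · rintro ⟨h, rfl⟩
          exact ⟨rfl, by rw [← h]; simp⟩
        · rintro ⟨rfl, h⟩
          exact ⟨by rw [Bool.eq_iff_iff, decide_eq_true_iff, h], rfl⟩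
      rw [this]
      refine (ih s).inter ?_
      cases b
      · simp only [Bool.false_eq_true, iff_false]
        exact (measurableSet_extends (true :: s)).compl
      · simpa using measurableSet_extends (true :: s)

theorem measurable_branch : Measurable branch := by
  refine measurable_pi_iff.2 fun n => measurable_to_bool ?_
  have : (fun T => branch T n) ⁻¹' {true} = ⋃ s : List Bool, {T | branchPrefix T n = s} ∩
      {T | ∀ N, Extends T N (true :: s)} := by
    ext T; simp [branch]
  rw [this]
  exact .iUnion fun s => (measurableSet_branchPrefix n s).inter (measurableSet_extends _)

/-! ### Gapped sets -/

section Gapped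

variable {X : Type*} (θ : X → ℕ → Bool)

/-- No two points of `B` have distance in `[r, 3r]`. -/
def Gapped (r : ℝ≥0∞) (B : Set X) : Prop :=
  ∀ x ∈ B, ∀ y ∈ B, summDist (θ x) (θ y) ≤ 3 * r → summDist (θ x) (θ y) < r

/-- `S` is covered by countably many gapped Borel sets. -/
def Small [MeasurableSpace X] (S : Set X) : Prop :=
  ∃ B : ℕ → Set X, (∀ k, MeasurableSet (B k)) ∧
    (∀ k, ∃ r : ℝ≥0∞, r ≠ 0 ∧ r ≠ ⊤ ∧ Gapped θ r (B k)) ∧ S ⊆ ⋃ k, B k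

variable {θ}

theorem Small.mono [MeasurableSpace X] {S T : Set X} (hT : Small θ T) (h : S ⊆ T) : Small θ S := by
  obtain ⟨B, h1, h2, h3⟩ := hT
  exact ⟨B, h1, h2, h.trans h3⟩

theorem Gapped.small [MeasurableSpace X] {r : ℝ≥0∞} {B : Set X} (h : Gapped θ r B) (h0 : r ≠ 0)
    (htop : r ≠ ⊤) (hB : MeasurableSet B) : Small θ B :=
  ⟨fun _ => B, fun _ => hB, fun _ => ⟨r, h0, htop, h⟩, fun _ hx => mem_iUnion.2 ⟨0, hx⟩⟩

theorem small_empty [MeasurableSpace X] : Small θ ∅ :=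
  ⟨fun _ => ∅, fun _ => .empty, fun _ => ⟨1, by simp, by simp, by simp [Gapped]⟩, by simp⟩

theorem Small.iUnion [MeasurableSpace X] {ι : Type*} [Countable ι] {S : ι → Set X}
    (h : ∀ i, Small θ (S i)) : Small θ (⋃ i, S i) := by
  cases isEmpty_or_nonempty ι
  · simpa using small_empty
  choose B h1 h2 h3 using h
  obtain ⟨e, he⟩ := exists_surjective_nat (ι × ℕ)
  refine ⟨fun k => B (e k).1 (e k).2, fun k => h1 _ _, fun k => h2 _ _, iUnion_subset fun i x hx => ?_⟩
  obtain ⟨n, hn⟩ := mem_iUnion.1 (h3 i hx)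
  obtain ⟨k, hk⟩ := he (i, n)
  exact mem_iUnion.2 ⟨k, by simpa [hk] using hn⟩

theorem measurable_summDist_comp [MeasurableSpace X] (hθ : Measurable θ) :
    Measurable fun p : X × X => summDist (θ p.1) (θ p.2) :=
  measurable_summDist.comp ((hθ.comp measurable_fst).prodMk (hθ.comp measurable_snd))

theorem measurable_tailDist_comp [MeasurableSpace X] (hθ : Measurable θ) (m : ℕ) :
    Measurable fun p : X × X => tailDist m (θ p.1) (θ p.2) :=
  (measurable_tailDist m).comp ((hθ.comp measurable_fst).prodMk (hθ.comp measurable_snd))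

variable [TopologicalSpace X] [PolishSpace X] [MeasurableSpace X] [BorelSpace X]

theorem Gapped.exists_measurable (hθ : Measurable θ) {r : ℝ≥0∞} {A : Set X} (hA : AnalyticSet A)
    (h : Gapped θ r A) : ∃ B, A ⊆ B ∧ MeasurableSet B ∧ Gapped θ r B := by
  have hd := measurable_summDist_comp hθ
  obtain ⟨B, hAB, hB, hind⟩ := exists_measurable_independent hA
    (D := {p : X × X | summDist (θ p.1) (θ p.2) ≤ 3 * r} ∩ {p | summDist (θ p.1) (θ p.2) < r}ᶜ)
    ((measurableSet_le hd measurable_const).inter (measurableSet_lt hd measurable_const).compl)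
    (fun x y hxy => by simpa [summDist_comm (θ y)] using hxy)
    (fun x hx y hy hxy => hxy.2 (h x hx y hy hxy.1))
  exact ⟨B, hAB, hB, fun x hx y hy hxy => by_contra fun hlt => hind x hx y hy ⟨hxy, hlt⟩⟩

/-- In an analytic set which is not small, the points with a partner at distance in `[r, 3r]`
do not form a small set. -/
theorem not_small_exists_partner (hθ : Measurable θ) {A : Set X} (hA : AnalyticSet A)
    (hpos : ¬ Small θ A) {r : ℝ≥0∞} (h0 : r ≠ 0) (htop : r ≠ ⊤) :
    ¬ Small θ {x ∈ A | ∃ y ∈ A, r ≤ summDist (θ x) (θ y) ∧ summDist (θ x) (θ y) ≤ 3 * r} := by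
  intro hsmall
  obtain ⟨C, hC, hCg, hsub⟩ := hsmall
  refine hpos ?_
  have hCm : MeasurableSet (⋃ k, C k) := .iUnion hC
  have hgap : Gapped θ r (A ∩ (⋃ k, C k)ᶜ) := fun x hx y hy hxy => by
    by_contra hlt
    exact hx.2 (hsub ⟨hx.1, y, hy.1, not_lt.1 hlt, hxy⟩)
  obtain ⟨B, hAB, hB, hBg⟩ := hgap.exists_measurable hθ (hA.inter hCm.compl.analyticSet)
  have h1 : Small θ (⋃ b : Bool, cond b B (⋃ k, C k)) := .iUnion fun b => by
    cases b
    · exact ⟨C, hC, hCg, subset_rfl⟩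
    · exact hBg.small h0 htop hB
  refine h1.mono fun x hx => mem_iUnion.2 ?_
  by_cases h : x ∈ ⋃ k, C k
  · exact ⟨false, h⟩
  · exact ⟨true, hAB ⟨hx, h⟩⟩

/-- On a gapped Borel set one can choose, in a Borel and invariant way, a nearby point of `ℕ → Bool`
for each class of points at small distance. -/
theorem Gapped.exists_selector (hθ : Measurable θ) {r : ℝ≥0∞} (hr : r ≠ 0) {B : Set X}
    (h : Gapped θ r B) (hB : MeasurableSet B) : ∃ c : X → ℕ → Bool, Measurable c ∧
      (∀ x ∈ B, summDist (c x) (θ x) ≤ r) ∧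
      ∀ x ∈ B, ∀ y ∈ B, summDist (θ x) (θ y) < r → c x = c y := by
  have hd := measurable_summDist_comp hθ
  set F : Set (X × X) := {p | p.1 ∈ B ∧ p.2 ∈ B ∧ summDist (θ p.1) (θ p.2) < r}
  have hF : MeasurableSet F :=
    (measurable_fst hB).inter ((measurable_snd hB).inter (measurableSet_lt hd measurable_const))
  have hFsymm : ∀ x y, (x, y) ∈ F → (y, x) ∈ F := fun x y hxy =>
    ⟨hxy.2.1, hxy.1, by simpa [summDist_comm (θ y)] using hxy.2.2⟩
  have hFtrans : ∀ x y z, (x, y) ∈ F → (y, z) ∈ F → (x, z) ∈ F := by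
    rintro x y z ⟨hx, hy, hxy⟩ ⟨-, hz, hyz⟩
    refine ⟨hx, hz, h x hx z hz ((summDist_triangle _ (θ y) _).trans ?_)⟩
    calc _ ≤ r + r := add_le_add hxy.le hyz.le
      _ = 2 * r := (two_mul r).symm
      _ ≤ 3 * r := by gcongr; norm_num
  -- `far s` consists of the lists that are far from `s`.
  let far : List Bool → Set (List Bool) := fun s =>
    {t | ∃ a b : ℕ → Bool, res a s.length = s ∧ res b s.length = t ∧ r < blockDist 0 s.length a b}
  have hres : ∀ n S, MeasurableSet {x | res (θ x) n ∈ S} := fun n S =>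
    hθ (isClopen_res_mem n S).isOpen.measurableSet
  have hsep : ∀ s : List Bool, ∃ V : Set X, MeasurableSet V ∧
      (∀ x ∈ B, res (θ x) s.length = s → x ∈ V) ∧
      (∀ x ∈ B, res (θ x) s.length ∈ far s → x ∉ V) ∧
      ∀ x y, (x, y) ∈ F → y ∈ V → x ∈ V := by
    intro s
    obtain ⟨V, h1, h2, h3, h4⟩ := exists_measurable_invariant
      (A₀ := {x | ∃ y ∈ {y | res (θ y) s.length ∈ ({s} : Set (List Bool))}, (x, y) ∈ F})
      (A₁ := {x | ∃ y ∈ {y | res (θ y) s.length ∈ far s}, (x, y) ∈ F})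
      (analyticSet_exists_rel (hres _ _).analyticSet hF)
      (analyticSet_exists_rel (hres _ _).analyticSet hF)
      (by
        refine disjoint_left.2 ?_
        rintro x ⟨y, hy, hxy⟩ ⟨z, ⟨a, b, ha, hb, hab⟩, hxz⟩
        have hyz := (hFtrans _ _ _ (hFsymm _ _ hxy) hxz).2.2
        have hy' : res (θ y) s.length = s := hy
        rw [blockDist_congr (a' := θ y) (b' := θ z) (fun k hk => res_eq_res.1 (ha.trans hy'.symm) hk)
          (fun k hk => res_eq_res.1 hb hk)] at hab
        exact absurd (hab.trans_le (blockDist_le_tailDist (Nat.zero_le _) _ _)) hyz.le.not_gt)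
      hF (fun x y hxy ⟨z, hz, hxz⟩ => ⟨z, hz, hFtrans _ _ _ (hFsymm _ _ hxy) hxz⟩)
    have hrefl : ∀ x ∈ B, (x, x) ∈ F := fun x hx =>
      ⟨hx, hx, by simpa [summDist_self] using pos_iff_ne_zero.2 hr⟩
    exact ⟨V, h2, fun x hx hxs => h1 ⟨x, hxs, hrefl x hx⟩,
      fun x hx hxs hxV => disjoint_left.1 h3 hxV ⟨x, hxs, hrefl x hx⟩, h4⟩
  choose V hV hnear hfar hinv using hsep
  refine ⟨fun x => branch {s | x ∈ V s}, measurable_branch.comp ?_, fun x hx => ?_,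
    fun x hx y hy hxy => ?_⟩
  · exact measurable_set_iff.2 fun s => measurableSet_setOfPred.1 (hV s)
  · have hmem : ∀ n, x ∈ V (res (branch {s | x ∈ V s}) n) := fun n =>
      res_branch_mem (T := {s | x ∈ V s}) (z := θ x)
        (fun n => hnear _ x hx (by rw [res_length])) n
    rw [summDist_eq_iSup tendsto_id]
    refine iSup_le fun n => not_lt.1 fun hlt => hfar _ x hx ?_ (hmem n)
    exact ⟨branch {s | x ∈ V s}, θ x, by rw [res_length], rfl, by rwa [res_length]⟩
  · have hxyF : (x, y) ∈ F := ⟨hx, hy, hxy⟩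
    have : {s | x ∈ V s} = {s | y ∈ V s} := by
      ext s
      exact ⟨hinv s y x (hFsymm _ _ hxyF), hinv s x y hxyF⟩
    simp only [this]

end Gapped

instance : PolishSpace (ℕ → Bool) :=
  have : PolishSpace Bool := inferInstance
  inferInstance

/-- A set whose distinct points are at distance at least `r` meets each `E₂`-class countably. -/
theorem countable_of_separated {r : ℝ≥0∞} (hr : r ≠ 0) {T : Set (ℕ → Bool)}
    (hT : ∀ a ∈ T, ∀ b ∈ T, summDist a b < r → a = b) (a : ℕ → Bool) :
    {b ∈ T | E2 a b}.Countable := by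
  have hfin : ∀ b ∈ {b ∈ T | E2 a b}, ∃ m, tailDist m b a < r / 2 := fun b hb => by
    have hlim := tendsto_tailDist ((E2_iff b a).1 (E2_equivalence.symm hb.2))
    exact (hlim.eventually (gt_mem_nhds (ENNReal.half_pos hr))).exists
  choose! m hm using hfin
  refine MapsTo.countable_of_injOn (f := fun b => res b (m b)) (t := univ) (fun _ _ => mem_univ _)
    ?_ (to_countable _)
  intro b hb b' hb' heq
  have hlen : m b = m b' := by simpa using congrArg List.length heq
  refine hT b hb.1 b' hb'.1 ?_
  rw [← tailDist_zero, ← blockDist_add_tailDist (Nat.zero_le (m b)), blockDist_eq_zero, zero_add]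
  · calc tailDist (m b) b b' ≤ tailDist (m b) b a + tailDist (m b) a b' := tailDist_triangle _ _ _ _
      _ < r / 2 + r / 2 := by
        refine ENNReal.add_lt_add (hm b hb) ?_
        rw [tailDist_comm, hlen]
        exact hm b' hb'
      _ = r := ENNReal.add_halves r
  · simp only [← hlen] at heq
    exact fun k hk => res_eq_res.1 heq hk

/-- If the whole space is small, then the pullback of `E₂` is essentially countable. -/
theorem Small.essentiallyCountable {X : Type*} [TopologicalSpace X] [PolishSpace X]
    [MeasurableSpace X] [BorelSpace X] {θ : X → ℕ → Bool} (hθ : Measurable θ)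
    (h : Small θ univ) {E : X → X → Prop} (hE : ∀ x x', E x x' ↔ E2 (θ x) (θ x')) :
    EssentiallyCountable E := by
  classical
  obtain ⟨B, hB, hgap, hcov⟩ := h
  choose r hr0 hrtop hgap using hgap
  choose c hc hcθ hcinv using fun k => (hgap k).exists_selector hθ (hr0 k) (hB k)
  have hT : ∀ k, ∃ T : Set (ℕ → Bool), c k '' B k ⊆ T ∧ MeasurableSet T ∧
      ∀ a ∈ T, ∀ b ∈ T, summDist a b < r k → a = b := by
    intro k
    obtain ⟨T, h1, h2, h3⟩ := exists_measurable_independent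
      (D := {p : (ℕ → Bool) × (ℕ → Bool) | summDist p.1 p.2 < r k} ∩ {p | p.1 = p.2}ᶜ)
      ((hB k).analyticSet_image (hc k))
      ((measurableSet_lt measurable_summDist measurable_const).inter
        (measurableSet_eq_fun measurable_fst measurable_snd).compl)
      (fun a b hab => ⟨by simpa [summDist_comm b] using hab.1, fun h => hab.2 h.symm⟩)
      (by
        rintro _ ⟨x, hx, rfl⟩ _ ⟨y, hy, rfl⟩ ⟨hlt, hne⟩
        refine hne (hcinv k x hx y hy (hgap k x hx y hy ?_))
        calc summDist (θ x) (θ y)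
            ≤ summDist (θ x) (c k x) + (summDist (c k x) (c k y) + summDist (c k y) (θ y)) :=
              (summDist_triangle _ _ _).trans (add_le_add le_rfl (summDist_triangle _ _ _))
          _ ≤ r k + (r k + r k) := by
              refine add_le_add ?_ (add_le_add hlt.le (hcθ k y hy))
              rw [summDist_comm]
              exact hcθ k x hx
          _ = 3 * r k := by ring)
    exact ⟨T, h1, h2, fun a ha b hb hab => by_contra fun hne => h3 a ha b hb ⟨hab, hne⟩⟩
  choose T hcT hTm hTsep using hT
  let U : Set (ℕ → Bool) := ⋃ k, T k
  have hU : MeasurableSet U := .iUnion hTm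
  have hex : ∀ x, ∃ k, x ∈ B k := fun x => mem_iUnion.1 (hcov (mem_univ x))
  let φ : X → ℕ → Bool := fun x => c (Nat.find (hex x)) x
  have hφ : Measurable φ := by
    have hc' : Measurable fun p : ℕ × X => c p.1 p.2 := measurable_from_prod_countable_right hc
    exact hc'.comp ((measurable_find _ hB).prodMk measurable_id)
  have hφU : ∀ x, φ x ∈ U := fun x =>
    mem_iUnion.2 ⟨_, hcT _ ⟨x, Nat.find_spec (hex x), rfl⟩⟩
  have hφE : ∀ x, E2 (φ x) (θ x) := fun x => (E2_iff _ _).2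
    (ne_top_of_le_ne_top (hrtop _) (hcθ _ x (Nat.find_spec (hex x))))
  refine ⟨ℕ → Bool, inferInstance, fun a b => a = b ∨ (a ∈ U ∧ b ∈ U ∧ E2 a b), inferInstance,
    ⟨fun _ => Or.inl rfl, ?_, ?_⟩, ?_, fun a => ?_, φ, ?_, fun x y => ?_⟩
  · rintro a b (rfl | ⟨ha, hb, h⟩)
    · exact Or.inl rfl
    · exact Or.inr ⟨hb, ha, E2_equivalence.symm h⟩
  · rintro a b d (rfl | ⟨ha, hb, h⟩) (rfl | ⟨hb', hd, h'⟩)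
    · exact Or.inl rfl
    · exact Or.inr ⟨hb', hd, h'⟩
    · exact Or.inr ⟨ha, hb, h⟩
    · exact Or.inr ⟨ha, hd, E2_equivalence.trans h h'⟩
  · rw [← BorelSpace.measurable_eq (α := (ℕ → Bool) × (ℕ → Bool))]
    have : {p : (ℕ → Bool) × (ℕ → Bool) | p.1 = p.2 ∨ (p.1 ∈ U ∧ p.2 ∈ U ∧ E2 p.1 p.2)} =
        {p | p.1 = p.2} ∪ (Prod.fst ⁻¹' U ∩ (Prod.snd ⁻¹' U ∩ {p | summDist p.1 p.2 = ⊤}ᶜ)) := by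
      ext p; simp [E2_iff]
    rw [this]
    exact (measurableSet_eq_fun measurable_fst measurable_snd).union
      ((measurable_fst hU).inter ((measurable_snd hU).inter
        (measurable_summDist (measurableSet_singleton ⊤)).compl))
  · refine Countable.mono (s₂ := {a} ∪ ⋃ k, {b ∈ T k | E2 a b}) ?_
      ((countable_singleton a).union (countable_iUnion fun k =>
        countable_of_separated (hr0 k) (hTsep k) a))
    rintro b (rfl | ⟨-, hb, h⟩)
    · exact Or.inl rfl
    · obtain ⟨k, hk⟩ := mem_iUnion.1 hb
      exact Or.inr (mem_iUnion.2 ⟨k, hk, h⟩)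
  · rwa [← BorelSpace.measurable_eq (α := X), ← BorelSpace.measurable_eq (α := ℕ → Bool)]
  · have key : E x y ↔ E2 (φ x) (φ y) := by
      rw [hE]
      have hx := hφE x
      have hy := hφE y
      exact ⟨fun h => E2_equivalence.trans hx (E2_equivalence.trans h (E2_equivalence.symm hy)),
        fun h => E2_equivalence.trans (E2_equivalence.symm hx) (E2_equivalence.trans h hy)⟩
    rw [key]
    refine ⟨fun h => Or.inr ⟨hφU x, hφU y, h⟩, ?_⟩
    rintro (h | h)
    · rw [h]; exact E2_equivalence.refl _
    · exact h.2.2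

/-! ### Embedding `E₂` -/

section Fusion

/-- The `n`-th error bound. -/
noncomputable def err (n : ℕ) : ℝ≥0∞ := 2⁻¹ ^ n

theorem err_pos (n : ℕ) : 0 < err n := ENNReal.pow_pos (by simp) n

theorem tsum_err_ne_top : ∑' n, err n ≠ ⊤ := by
  unfold err
  rw [ENNReal.tsum_geometric, ENNReal.one_sub_inv_two, inv_inv]
  exact ENNReal.ofNat_ne_top

/-- The contribution of the coordinate `n` to the distance of sequences with values `i`, `j`
at `n`. -/
noncomputable def gap (n : ℕ) (i j : Bool) : ℝ≥0∞ :=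
  if i = j then 0 else ENNReal.ofReal (1 / (n + 1))

variable {X : Type*} [MetricSpace X] [MeasurableSpace X] (θ : X → ℕ → Bool)

/-- The state of the fusion construction at level `n`: a non-small analytic set `A` of base points,
together with closed sets `F s` indexed by the binary lists of length `n`, each containing points
close to any given base point. -/
structure Stage (n : ℕ) (A : Set X) (m : ℕ) (F : List Bool → Set X) : Prop where
  analytic : AnalyticSet A
  not_small : ¬ Small θ A
  agree_base : ∀ x ∈ A, ∀ x' ∈ A, ∀ k < m, θ x k = θ x' k
  approx : ∀ x ∈ A, ∀ s : List Bool, s.length = n → ∃ y ∈ F s, tailDist m (θ x) (θ y) < err n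
  agree : ∀ s : List Bool, s.length = n → ∀ y ∈ F s, ∀ y' ∈ F s, ∀ k < m, θ y k = θ y' k
  isClosed : ∀ s, IsClosed (F s)

/-- The points of `F'` and `F''` differ in `[m, m')` by approximately `gap n i j`. -/
def Calibrated (n m m' : ℕ) (i j : Bool) (F' F'' : Set X) : Prop :=
  ∀ y ∈ F', ∀ y' ∈ F'',
    blockDist m m' (θ y) (θ y') ≤ err n + err n + 3 * gap n i j ∧
    gap n i j ≤ blockDist m m' (θ y) (θ y') + (err n + err n) + err (n + 1)

/-- The requirements on the transition from level `n` to level `n + 1`. -/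
structure Refines (n m m' : ℕ) (F F' : List Bool → Set X) : Prop where
  lt : m < m'
  subset : ∀ s : List Bool, s.length = n → ∀ i, F' (i :: s) ⊆ F s
  dist_le : ∀ s : List Bool, s.length = n → ∀ i, ∀ y ∈ F' (i :: s), ∀ y' ∈ F' (i :: s),
    dist y y' ≤ (1 / 2) ^ n
  calibrated : ∀ s t : List Bool, s.length = n → t.length = n → ∀ i j,
    Calibrated θ n m m' i j (F' (i :: s)) (F' (j :: t))

variable {θ}

theorem blockDist_estimates {n m m' : ℕ} (hmm : m ≤ m') {i j : Bool} {a b u v : ℕ → Bool}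
    (hau : tailDist m a u < err n) (hbv : tailDist m b v < err n)
    (heq : i = j → a = b) (hagree : ∀ k < m, a k = b k)
    (hlow : i ≠ j → ENNReal.ofReal (1 / (n + 1)) ≤ summDist a b)
    (hup : i ≠ j → summDist a b ≤ 3 * ENNReal.ofReal (1 / (n + 1)))
    (htail : tailDist m' a b < err (n + 1)) :
    blockDist m m' u v ≤ err n + err n + 3 * gap n i j ∧
      gap n i j ≤ blockDist m m' u v + (err n + err n) + err (n + 1) := by
  have h1 := (blockDist_le_tailDist hmm a u).trans hau.le
  have h2 := (blockDist_le_tailDist hmm b v).trans hbv.le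
  have hsum : summDist a b = blockDist m m' a b + tailDist m' a b := by
    rw [← tailDist_zero, ← blockDist_add_tailDist (Nat.zero_le m), blockDist_eq_zero hagree,
      zero_add, blockDist_add_tailDist hmm]
  have hab : blockDist m m' a b ≤ 3 * gap n i j := by
    by_cases h : i = j
    · simp [heq h, blockDist, disagree_self]
    · simp only [gap, h, if_false]
      exact le_trans (hsum ▸ le_self_add) (hup h)
  have hab' : gap n i j ≤ blockDist m m' a b + tailDist m' a b := by
    by_cases h : i = j
    · simp [gap, h]
    · simp only [gap, h, if_false]
      exact hsum ▸ hlow h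
  constructor
  · calc blockDist m m' u v
        ≤ blockDist m m' u a + (blockDist m m' a b + blockDist m m' b v) :=
          (blockDist_triangle _ _ _ _ _).trans (add_le_add le_rfl (blockDist_triangle _ _ _ _ _))
      _ ≤ err n + (3 * gap n i j + err n) :=
          add_le_add (by rwa [blockDist_comm]) (add_le_add hab h2)
      _ = _ := by ring
  · calc gap n i j ≤ blockDist m m' a b + tailDist m' a b := hab'
      _ ≤ (blockDist m m' a u + (blockDist m m' u v + blockDist m m' v b)) + err (n + 1) :=
          add_le_add ((blockDist_triangle _ _ _ _ _).trans
            (add_le_add le_rfl (blockDist_triangle _ _ _ _ _))) htail.le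
      _ ≤ (err n + (blockDist m m' u v + err n)) + err (n + 1) := by
          refine add_le_add (add_le_add h1 (add_le_add le_rfl ?_)) le_rfl
          rwa [blockDist_comm]
      _ = _ := by ring

theorem Stage.exists_succ [CompleteSpace X] [SecondCountableTopology X] [BorelSpace X]
    (hθ : Continuous θ) {n m : ℕ} {A : Set X} {F : List Bool → Set X} (h : Stage θ n A m F) :
    ∃ A' m' F', Stage θ (n + 1) A' m' F' ∧ Refines θ n m m' F F' := by
  have hθm : Measurable θ := hθ.measurable
  have : Nonempty X := by
    by_contra hX
    rw [not_nonempty_iff] at hX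
    exact h.not_small (A.eq_empty_of_isEmpty ▸ small_empty)
  set r : ℝ≥0∞ := ENNReal.ofReal (1 / (n + 1)) with hr
  have hr0 : r ≠ 0 := by
    rw [hr, Ne, ENNReal.ofReal_eq_zero, not_le]
    positivity
  have hrtop : r ≠ ⊤ := ENNReal.ofReal_ne_top
  let A₁ : Set X :=
    {x ∈ A | ∃ y ∈ A, r ≤ summDist (θ x) (θ y) ∧ summDist (θ x) (θ y) ≤ 3 * r}
  have hA₁pos : ¬ Small θ A₁ := not_small_exists_partner hθm h.analytic h.not_small hr0 hrtop
  have hA₁ : AnalyticSet A₁ := by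
    have hd := measurable_summDist_comp hθm
    exact h.analytic.inter (analyticSet_exists_rel h.analytic
      ((measurableSet_le measurable_const hd).inter (measurableSet_le hd measurable_const)))
  -- Countably many shrinkings of the sets `F s`, given by finite data.
  let κ := ℕ × List Bool × (List.Vector Bool (n + 1) → ℕ × List Bool)
  let ball : ℕ → Set X := fun q => Metric.closedBall (TopologicalSpace.denseSeq X q) ((1 / 2) ^ n / 2)
  let G : κ → List Bool → Set X := fun d l =>
    if hl : l.length = n + 1 then
      F l.tail ∩ ball (d.2.2 ⟨l, hl⟩).1 ∩ {y | res (θ y) d.1 ∈ ({(d.2.2 ⟨l, hl⟩).2} : Set (List Bool))}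
    else univ
  have hres : ∀ k S, IsClopen {x | res (θ x) k ∈ S} := fun k S => (isClopen_res_mem k S).preimage hθ
  have hG : ∀ d l, IsClosed (G d l) := by
    intro d l
    by_cases hl : l.length = n + 1
    · simp only [G, dif_pos hl]
      exact ((h.isClosed _).inter Metric.isClosed_closedBall).inter (hres _ _).isClosed
    · simp only [G, dif_neg hl]
      exact isClosed_univ
  let part : κ → Set X := fun d => A₁ ∩ {x | res (θ x) d.1 ∈ ({d.2.1} : Set (List Bool))} ∩
    ⋂ v : List.Vector Bool (n + 1), {x | ∃ y ∈ G d v.1,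
      (x, y) ∈ {p : X × X | tailDist d.1 (θ p.1) (θ p.2) < err (n + 1)}}
  have hpart : ∀ d, AnalyticSet (part d) := fun d =>
    (hA₁.inter (hres _ _).isClosed.analyticSet).inter (AnalyticSet.iInter fun v =>
      analyticSet_exists_rel (hG d v.1).analyticSet
        (measurableSet_lt (measurable_tailDist_comp hθm _) measurable_const))
  let Good : κ → Prop := fun d => m < d.1 ∧ ∀ s t : List Bool, s.length = n → t.length = n →
    ∀ i j, Calibrated θ n m d.1 i j (G d (i :: s)) (G d (j :: t))
  have hcover : A₁ ⊆ ⋃ d : {d // Good d}, part d.1 := by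
    rintro x ⟨hx, x', hx', hlow, hup⟩
    let pt : Bool → X := fun i => cond i x' x
    have hpt : ∀ i, pt i ∈ A := fun i => by cases i <;> assumption
    have hxx' : summDist (θ x) (θ x') ≠ ⊤ :=
      ne_top_of_le_ne_top (ENNReal.mul_ne_top (by simp) hrtop) hup
    have hbase : ∀ i, summDist (θ x) (θ (pt i)) ≠ ⊤ := fun i => by
      cases i
      · simp [pt, summDist_self]
      · exact hxx'
    have happ := fun i => h.approx (pt i) (hpt i)
    choose! y hyF hytail using happ
    let Y : List Bool → X := fun l => y (l.headD false) l.tail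
    have hYlim : ∀ v : List.Vector Bool (n + 1),
        ∀ᶠ k in atTop, tailDist k (θ x) (θ (Y v.1)) < err (n + 1) := by
      intro v
      have hlen : v.1.tail.length = n := by simp [v.2]
      have hfin := (summDist_ne_top_iff m _ _).2 (hytail (v.1.headD false) _ hlen).ne_top
      exact (tendsto_tailDist (ne_top_of_le_ne_top (ENNReal.add_ne_top.2 ⟨hbase _, hfin⟩)
        (summDist_triangle _ _ _))).eventually (gt_mem_nhds (err_pos _))
    obtain ⟨m', hm', htail, hY⟩ := ((eventually_gt_atTop m).and
      (((tendsto_tailDist hxx').eventually (gt_mem_nhds (err_pos (n + 1)))).and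
        (eventually_all.2 hYlim))).exists
    have hq : ∀ v : List.Vector Bool (n + 1), ∃ q, Y v.1 ∈ ball q := fun v => by
      obtain ⟨q, hq⟩ := (TopologicalSpace.denseRange_denseSeq X).exists_dist_lt (Y v.1)
        (ε := (1 / 2) ^ n / 2) (by positivity)
      exact ⟨q, hq.le⟩
    choose q hq using hq
    let d : κ := (m', res (θ x) m', fun v => (q v, res (θ (Y v.1)) m'))
    have hYG : ∀ v : List.Vector Bool (n + 1), Y v.1 ∈ G d v.1 := fun v => by
      simp only [G, dif_pos v.2]
      exact ⟨⟨hyF _ _ (by simp [v.2]), hq v⟩, rfl⟩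
    have hagree : ∀ i (s : List Bool), s.length = n → ∀ z ∈ G d (i :: s), ∀ k < m',
        θ z k = θ (y i s) k := by
      intro i s hs z hz k hk
      have hl : (i :: s).length = n + 1 := by simp [hs]
      simp only [G, dif_pos hl] at hz
      exact res_eq_res.1 (show res (θ z) m' = res (θ (y i s)) m' from hz.2) hk
    have hgood : Good d := by
      refine ⟨hm', fun s t hs ht i j z hz z' hz' => ?_⟩
      rw [show d.1 = m' from rfl, blockDist_congr (hagree i s hs z hz) (hagree j t ht z' hz')]
      refine blockDist_estimates (a := θ (pt i)) (b := θ (pt j)) hm'.le (hytail i s hs)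
        (hytail j t ht) (by rintro rfl; rfl) (h.agree_base _ (hpt i) _ (hpt j)) ?_ ?_ ?_
      · cases i <;> cases j <;> simp only [ne_eq, not_true_eq_false, false_imp_iff, reduceCtorEq,
          not_false_eq_true, forall_true_left]
        · exact hlow
        · rw [summDist_comm]; exact hlow
      · cases i <;> cases j <;> simp only [ne_eq, not_true_eq_false, false_imp_iff, reduceCtorEq,
          not_false_eq_true, forall_true_left]
        · exact hup
        · rw [summDist_comm]; exact hup
      · cases i <;> cases j
        · simpa [tailDist_self] using err_pos (n + 1)
        · exact htail
        · rw [tailDist_comm]; exact htail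
        · simpa [tailDist_self] using err_pos (n + 1)
    refine mem_iUnion.2 ⟨⟨d, hgood⟩, ⟨⟨hx, x', hx', hlow, hup⟩, rfl⟩, mem_iInter.2 fun v => ?_⟩
    exact ⟨Y v.1, hYG v, hY v⟩
  obtain ⟨⟨d, hd⟩, hdpos⟩ : ∃ d : {d // Good d}, ¬ Small θ (part d.1) := by
    by_contra! hall
    exact hA₁pos ((Small.iUnion hall).mono hcover)
  have hGmem : ∀ l (hl : l.length = n + 1), ∀ y ∈ G d l, y ∈ F l.tail ∧
      y ∈ ball (d.2.2 ⟨l, hl⟩).1 ∧ res (θ y) d.1 = (d.2.2 ⟨l, hl⟩).2 := by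
    intro l hl y hy
    simp only [G, dif_pos hl] at hy
    exact ⟨hy.1.1, hy.1.2, hy.2⟩
  refine ⟨part d, d.1, G d, ⟨hpart d, hdpos, ?_, ?_, ?_, hG d⟩, ⟨hd.1, ?_, ?_, hd.2⟩⟩
  · intro x hx x' hx' k hk
    have h1 : res (θ x) d.1 = d.2.1 := hx.1.2
    have h2 : res (θ x') d.1 = d.2.1 := hx'.1.2
    exact res_eq_res.1 (h1.trans h2.symm) hk
  · exact fun x hx s hs => mem_iInter.1 hx.2 ⟨s, hs⟩
  · exact fun s hs y hy y' hy' k hk =>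
      res_eq_res.1 ((hGmem s hs y hy).2.2.trans (hGmem s hs y' hy').2.2.symm) hk
  · exact fun s hs i y hy => (hGmem (i :: s) (by simp [hs]) y hy).1
  · intro s hs i y hy y' hy'
    have hl : (i :: s).length = n + 1 := by simp [hs]
    have h1 := (hGmem _ hl y hy).2.1
    have h2 := (hGmem _ hl y' hy').2.1
    exact (dist_triangle_right _ _ _).trans ((add_le_add h1 h2).trans (add_halves _).le)

/-- If the whole space is not small, then `E₂` reduces to its pullback. -/
theorem exists_reduction_of_not_small [CompleteSpace X] [SecondCountableTopology X] [BorelSpace X]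
    (hθ : Continuous θ) (h : ¬ Small θ univ) :
    ∃ φ : (ℕ → Bool) → X, Continuous φ ∧ ∀ z z', E2 z z' ↔ E2 (θ (φ z)) (θ (φ z')) := by
  have h0 : Stage θ 0 univ 0 (fun _ => univ) :=
    ⟨isClosed_univ.analyticSet, h, by simp, fun x _ s _ => ⟨x, mem_univ x, by
      simpa [tailDist_self] using err_pos 0⟩, by simp, fun _ => isClosed_univ⟩
  have hstep : ∀ (n : ℕ) (σ : Set X × ℕ × (List Bool → Set X)),
      ∃ σ' : Set X × ℕ × (List Bool → Set X),
      Stage θ n σ.1 σ.2.1 σ.2.2 →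
        Stage θ (n + 1) σ'.1 σ'.2.1 σ'.2.2 ∧ Refines θ n σ.2.1 σ'.2.1 σ.2.2 σ'.2.2 := by
    intro n σ
    by_cases hσ : Stage θ n σ.1 σ.2.1 σ.2.2
    · obtain ⟨A', m', F', h'⟩ := hσ.exists_succ hθ
      exact ⟨(A', m', F'), fun _ => h'⟩
    · exact ⟨σ, fun h' => absurd h' hσ⟩
  choose next hnext using hstep
  let σ : ℕ → Set X × ℕ × (List Bool → Set X) := fun n =>
    Nat.rec (univ, 0, fun _ => univ) next n
  have hσ : ∀ n, Stage θ n (σ n).1 (σ n).2.1 (σ n).2.2 := by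
    intro n
    induction n with
    | zero => exact h0
    | succ n ih => exact (hnext n (σ n) ih).1
  have href : ∀ n, Refines θ n (σ n).2.1 (σ (n + 1)).2.1 (σ n).2.2 (σ (n + 1)).2.2 := fun n =>
    (hnext n (σ n) (hσ n)).2
  set m : ℕ → ℕ := fun n => (σ n).2.1
  set F : ℕ → List Bool → Set X := fun n => (σ n).2.2
  have hm0 : m 0 = 0 := rfl
  have hm : StrictMono m := strictMono_nat_of_lt_succ fun n => (href n).lt
  have hne : ∀ n (z : ℕ → Bool), (F n (res z n)).Nonempty := by
    intro n z
    obtain ⟨x, hx⟩ : (σ n).1.Nonempty := by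
      rw [nonempty_iff_ne_empty]
      intro hempty
      exact (hσ n).not_small (hempty ▸ small_empty)
    obtain ⟨y, hy, -⟩ := (hσ n).approx x hx (res z n) (by simp)
    exact ⟨y, hy⟩
  have hanti : ∀ z : ℕ → Bool, Antitone fun n => F n (res z n) := fun z =>
    antitone_nat_of_succ_le fun n => (href n).subset (res z n) (by simp) (z n)
  have hdist : ∀ n (z : ℕ → Bool), ∀ y ∈ F (n + 1) (res z (n + 1)),
      ∀ y' ∈ F (n + 1) (res z (n + 1)),
      dist y y' ≤ (1 / 2) ^ n := fun n z => (href n).dist_le (res z n) (by simp) (z n)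
  choose p hp using hne
  have hcauchy : ∀ z, CauchySeq fun n => p (n + 1) z := fun z =>
    cauchySeq_of_le_tendsto_0 (fun n => (1 / 2 : ℝ) ^ n)
      (fun a b N ha hb => hdist N z _ (hanti z (by lia : N + 1 ≤ a + 1) (hp (a + 1) z)) _
        (hanti z (by lia : N + 1 ≤ b + 1) (hp (b + 1) z)))
      (tendsto_pow_atTop_nhds_zero_of_lt_one (by norm_num) (by norm_num))
  choose φ hφ using fun z => cauchySeq_tendsto_of_complete (hcauchy z)
  have hφF : ∀ n z, φ z ∈ F n (res z n) := fun n z =>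
    ((hσ n).isClosed _).mem_of_tendsto (hφ z) (by
      filter_upwards [eventually_ge_atTop n] with k hk
      exact hanti z (by lia : n ≤ k + 1) (hp (k + 1) z))
  refine ⟨φ, ?_, fun z z' => ?_⟩
  · refine continuous_iff_continuousAt.2 fun z => Metric.tendsto_nhds.2 fun ε hε => ?_
    obtain ⟨n, hn⟩ := exists_pow_lt_of_lt_one hε (by norm_num : (1 / 2 : ℝ) < 1)
    have hopen := (isClopen_res_mem (n + 1) {res z (n + 1)}).isOpen.mem_nhds
      (show res z (n + 1) ∈ ({res z (n + 1)} : Set (List Bool)) from rfl)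
    filter_upwards [hopen] with w hw
    have hw' : res w (n + 1) = res z (n + 1) := hw
    exact (hdist n z _ (hw' ▸ hφF (n + 1) w) _ (hφF (n + 1) z)).trans_lt hn
  · have hcal : ∀ n, blockDist (m n) (m (n + 1)) (θ (φ z)) (θ (φ z')) ≤
          err n + err n + 3 * disagree z z' n ∧
        disagree z z' n ≤ blockDist (m n) (m (n + 1)) (θ (φ z)) (θ (φ z')) +
          (err n + err n) + err (n + 1) := fun n =>
      (href n).calibrated (res z n) (res z' n) (by simp) (by simp) (z n) (z' n)
        _ (hφF (n + 1) z) _ (hφF (n + 1) z')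
    have herr := tsum_err_ne_top
    have herr' : ∑' n, err (n + 1) ≠ ⊤ :=
      ne_top_of_le_ne_top herr (ENNReal.tsum_comp_le_tsum_of_injective (add_left_injective 1) _)
    rw [E2_iff, E2_iff, summDist_eq_tsum_blockDist hm0 hm (θ (φ z))]
    constructor
    · intro hz
      refine ne_top_of_le_ne_top ?_ (ENNReal.tsum_le_tsum fun n => (hcal n).1)
      rw [ENNReal.tsum_add, ENNReal.tsum_add, ENNReal.tsum_mul_left]
      exact ENNReal.add_ne_top.2 ⟨ENNReal.add_ne_top.2 ⟨herr, herr⟩,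
        ENNReal.mul_ne_top (by simp) hz⟩
    · intro hz
      refine ne_top_of_le_ne_top ?_ (ENNReal.tsum_le_tsum fun n => (hcal n).2)
      rw [ENNReal.tsum_add, ENNReal.tsum_add, ENNReal.tsum_add]
      exact ENNReal.add_ne_top.2 ⟨ENNReal.add_ne_top.2 ⟨hz,
        ENNReal.add_ne_top.2 ⟨herr, herr⟩⟩, herr'⟩

theorem exists_borel_reduction_of_not_small_of_continuous {Y : Type*} [TopologicalSpace Y]
    [PolishSpace Y] [MeasurableSpace Y] [BorelSpace Y] {θ : Y → ℕ → Bool} (hθ : Continuous θ)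
    (h : ¬ Small θ univ) :
    ∃ φ : (ℕ → Bool) → Y, Measurable φ ∧ ∀ z z', E2 z z' ↔ E2 (θ (φ z)) (θ (φ z')) := by
  let := TopologicalSpace.upgradeIsCompletelyMetrizable Y
  obtain ⟨φ, hφ, hφE⟩ := exists_reduction_of_not_small hθ h
  exact ⟨φ, hφ.measurable, hφE⟩

theorem exists_borel_reduction_of_not_small {Y : Type*} [t : TopologicalSpace Y]
    [hY : PolishSpace Y] [MeasurableSpace Y] [hB : BorelSpace Y] {θ : Y → ℕ → Bool}
    (hθ : Measurable θ) (h : ¬ Small θ univ) :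
    ∃ φ : (ℕ → Bool) → Y, Measurable φ ∧ ∀ z z', E2 z z' ↔ E2 (θ (φ z)) (θ (φ z')) := by
  obtain ⟨t', hle, hcont, hY'⟩ := hθ.exists_continuous
  have hborel : @borel Y t' = @borel Y t := borel_eq_borel_of_le hY' hY hle
  exact @exists_borel_reduction_of_not_small_of_continuous Y t' hY' _
    (@BorelSpace.mk Y t' _ (hB.measurable_eq.trans hborel.symm)) θ hcont h

end Fusion

end FourthDichotomy


/-- Hjorth, 4th dichotomy: if a Borel equivalence relation `E` on a
Polish space is Borel reducible to `E₂`, then either `E₂ ≤B E` (so `E ∼B E₂`), or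
`E` is essentially countable. -/
theorem fourth_dichotomy
    {X : Type*} [TopologicalSpace X] [PolishSpace X]
    (E : X → X → Prop) (hE : Equivalence E)
    (hBorel : MeasurableSet[borel (X × X)] {p : X × X | E p.1 p.2})
    (hred : BorelReducible E E2) :
    BorelReducible E2 E ∨ EssentiallyCountable E := by
  obtain ⟨θ, hθ, hEθ⟩ := hred
  rw [← BorelSpace.measurable_eq (α := ℕ → Bool)] at hθ
  let : MeasurableSpace X := borel X
  have : BorelSpace X := ⟨rfl⟩
  by_cases hsmall : FourthDichotomy.Small θ Set.univ
  · exact .inr (hsmall.essentiallyCountable hθ hEθ)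
  · obtain ⟨φ, hφ, hE2⟩ := FourthDichotomy.exists_borel_reduction_of_not_small hθ hsmall
    refine .inl ⟨φ, ?_, fun z z' => (hE2 z z').trans (hEθ _ _).symm⟩
    rwa [← BorelSpace.measurable_eq (α := ℕ → Bool)]
end

section
/- Let E be a Borel equivalence relation on a Polish space such that E is Borel reducible to E₃. Then either E is Borel reducible to E₀, or E₃ is Borel reducible to E (so that E is Borel bireducible with E₃). -/
open MeasureTheory

/-- `E₀`: eventual equality on Cantor space `2^ℕ`. -/
def E0 (x y : ℕ → Bool) : Prop := {n : ℕ | x n ≠ y n}.Finite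

/-- `E₃`: componentwise eventual equality on `(2^ℕ)^ℕ`. -/
def E3 (x y : ℕ → ℕ → Bool) : Prop := ∀ k : ℕ, {n : ℕ | x k n ≠ y k n}.Finite

namespace SixthDichotomy

section Separation

variable {X : Type*} [TopologicalSpace X] [PolishSpace X] [MeasurableSpace X] [BorelSpace X]

lemma analyticSet_image_rel {R : X → X → Prop} (hR : MeasurableSet {p : X × X | R p.1 p.2})
    {A : Set X} (hA : AnalyticSet A) : AnalyticSet {y | ∃ x ∈ A, R x y} := by
  have h1 : AnalyticSet ({p : X × X | R p.1 p.2} ∩ Prod.fst ⁻¹' A) := by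
    rw [Set.inter_eq_iInter]
    exact AnalyticSet.iInter (Bool.rec (hA.preimage continuous_fst) hR.analyticSet)
  convert h1.image_of_continuous continuous_snd using 1
  ext y
  constructor
  · rintro ⟨x, hx, hxy⟩
    exact ⟨(x, y), ⟨hxy, hx⟩, rfl⟩
  · rintro ⟨⟨x, y'⟩, ⟨hxy, hx⟩, rfl⟩
    exact ⟨x, hx, hxy⟩

/-- Disjoint analytic sets with disjoint saturations are separated by an invariant Borel set. -/
lemma exists_invariant_separation {S : X → X → Prop} (hS : Equivalence S)
    (hSm : MeasurableSet {p : X × X | S p.1 p.2}) {P Q : Set X} (hP : AnalyticSet P)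
    (hQ : AnalyticSet Q) (hPQ : ∀ x ∈ P, ∀ y ∈ Q, ¬ S x y) :
    ∃ B : Set X, MeasurableSet B ∧ (∀ x y, S x y → x ∈ B → y ∈ B) ∧ P ⊆ B ∧ ∀ x ∈ Q, x ∉ B := by
  let T := {A : Set X // AnalyticSet A ∧ ∀ x ∈ A, ∀ y ∈ Q, ¬ S x y}
  have step : ∀ A : T, ∃ B : T, MeasurableSet B.1 ∧ ∀ x ∈ A.1, ∀ y, S x y → y ∈ B.1 := by
    rintro ⟨A, hA, hAQ⟩
    have hdisj : Disjoint {y | ∃ x ∈ A, S x y} {y | ∃ x ∈ Q, S x y} := by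
      rw [Set.disjoint_left]
      rintro y ⟨x, hx, hxy⟩ ⟨z, hz, hzy⟩
      exact hAQ x hx z hz (hS.trans hxy (hS.symm hzy))
    obtain ⟨B, hAB, hBQ, hB⟩ := AnalyticSet.measurablySeparable
      (analyticSet_image_rel hSm hA) (analyticSet_image_rel hSm hQ) hdisj
    refine ⟨⟨B, hB.analyticSet, fun x hx y hy hxy => ?_⟩, hB, fun x hx y hxy => hAB ⟨x, hx, hxy⟩⟩
    exact Set.disjoint_left.1 hBQ ⟨y, hy, hS.symm hxy⟩ hx
  choose F hFm hF using step
  let B : ℕ → T := fun n => F^[n + 1] ⟨P, hP, hPQ⟩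
  have hBs : ∀ n, B (n + 1) = F (B n) := fun n => Function.iterate_succ_apply' F (n + 1) _
  have hBm : ∀ n, MeasurableSet (B n).1 := by
    intro n
    have : B n = F (F^[n] ⟨P, hP, hPQ⟩) := Function.iterate_succ_apply' F n _
    rw [this]
    exact hFm _
  refine ⟨⋃ n, (B n).1, MeasurableSet.iUnion hBm, ?_, ?_, ?_⟩
  · intro x y hxy hx
    obtain ⟨n, hn⟩ := Set.mem_iUnion.1 hx
    refine Set.mem_iUnion.2 ⟨n + 1, ?_⟩
    rw [hBs]
    exact hF _ x hn y hxy
  · intro x hx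
    exact Set.mem_iUnion.2 ⟨0, hF _ x hx x (hS.refl x)⟩
  · intro x hx hxB
    obtain ⟨n, hn⟩ := Set.mem_iUnion.1 hxB
    exact (B n).2.2 x hn x hx (hS.refl x)

/-- An analytic set that is independent for an invariant Borel relation is contained in an
invariant Borel independent set. -/
lemma exists_invariant_independent_superset {S : X → X → Prop} (hS : Equivalence S)
    (hSm : MeasurableSet {p : X × X | S p.1 p.2}) {R : X → X → Prop}
    (hRm : MeasurableSet {p : X × X | R p.1 p.2}) (hRsymm : ∀ x y, R x y → R y x)
    (hRS : ∀ x y z, R x y → S y z → R x z) {A : Set X} (hA : AnalyticSet A)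
    (hAR : ∀ x ∈ A, ∀ y ∈ A, ¬ R x y) :
    ∃ B : Set X, MeasurableSet B ∧ (∀ x y, S x y → x ∈ B → y ∈ B) ∧ A ⊆ B ∧
      ∀ x ∈ B, ∀ y ∈ B, ¬ R x y := by
  obtain ⟨B, hBm, hBS, hAB, hB⟩ := exists_invariant_separation hS hSm hA
    (analyticSet_image_rel hRm hA) (by
      rintro x hx y ⟨z, hz, hzy⟩ hxy
      exact hAR z hz x hx (hRS _ _ _ hzy (hS.symm hxy)))
  obtain ⟨C, hCm, hCS, hAC, hC⟩ := exists_invariant_separation hS hSm hA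
    (analyticSet_image_rel hRm hBm.analyticSet) (by
      rintro x hx y ⟨z, hz, hzy⟩ hxy
      exact hB z ⟨x, hx, hRsymm _ _ (hRS _ _ _ hzy (hS.symm hxy))⟩ hz)
  refine ⟨B ∩ C, hBm.inter hCm, fun x y hxy hx => ⟨hBS x y hxy hx.1, hCS x y hxy hx.2⟩,
    Set.subset_inter hAB hAC, fun x hx y hy hxy => hC y ⟨x, hx.1, hxy⟩ hy.2⟩

end Separation

lemma equivalence_E3 : Equivalence E3 where
  refl _ _ := by simp
  symm {x y} h k := (h k).subset fun n hn => Ne.symm hn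
  trans {x y z} h h' k := by
    refine ((h k).union (h' k)).subset fun n hn => ?_
    by_contra hc
    simp only [Set.mem_union, Set.mem_ofPred_eq, not_or, not_not] at hc
    exact hn (hc.1.trans hc.2)

lemma exists_forall_ge_eq {x y : ℕ → ℕ → Bool} (h : E3 x y) (j : ℕ) :
    ∃ N, ∀ i < j, ∀ m ≥ N, x i m = y i m := by
  have hfin : (⋃ i ∈ Set.Iio j, {m | x i m ≠ y i m}).Finite :=
    (Set.finite_Iio j).biUnion fun i _ => h i
  obtain ⟨N, hN⟩ := hfin.bddAbove
  refine ⟨N + 1, fun i hi m hm => ?_⟩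
  by_contra hne
  have : m ≤ N := hN (Set.mem_biUnion (Set.mem_Iio.2 hi) hne)
  omega

lemma finite_setOf_ne_iff {x y : ℕ → Bool} :
    {m | x m ≠ y m}.Finite ↔ ∃ N, ∀ m ≥ N, x m = y m := by
  constructor
  · intro h
    obtain ⟨N, hN⟩ := h.bddAbove
    refine ⟨N + 1, fun m hm => ?_⟩
    by_contra hne
    have : m ≤ N := hN hne
    omega
  · rintro ⟨N, hN⟩
    refine (Set.finite_Iio N).subset fun m hm => ?_
    by_contra hlt
    exact hm (hN m (not_lt.1 hlt))

section Relations

variable {X : Type*}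

/-- The pairs that are `E3`-equivalent via `θ` and on whose first `k` coordinates `θ` agrees. -/
def SameHead (θ : X → ℕ → ℕ → Bool) (k : ℕ) (x y : X) : Prop :=
  E3 (θ x) (θ y) ∧ ∀ i < k, θ x i = θ y i

/-- On `A`, the relation `SameHead θ k` implies agreement of the first `j` coordinates of `θ`
from position `N` on. -/
def Thin (θ : X → ℕ → ℕ → Bool) (k j N : ℕ) (A : Set X) : Prop :=
  ∀ x ∈ A, ∀ y ∈ A, SameHead θ k x y → ∀ i < j, ∀ m ≥ N, θ x i m = θ y i m

/-- `B` is an invariant Borel set on which the pullback of `E3` by `θ` reduces to `E0`. -/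
def Good [MeasurableSpace X] (θ : X → ℕ → ℕ → Bool) (B : Set X) : Prop :=
  MeasurableSet B ∧ (∀ x y, E3 (θ x) (θ y) → x ∈ B → y ∈ B) ∧
    ∃ ρ : X → ℕ → Bool, Measurable ρ ∧ ∀ x ∈ B, ∀ y ∈ B, E3 (θ x) (θ y) ↔ E0 (ρ x) (ρ y)

/-- The Borel sets that are `Thin θ k j N` for some `N`. -/
def thinSets [MeasurableSpace X] (θ : X → ℕ → ℕ → Bool) (k j : ℕ) : Set (Set X) :=
  {A | MeasurableSet A ∧ ∃ N, Thin θ k j N A}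

/-- `Y` is covered by countably many members of `G`. -/
def Small (G : Set (Set X)) (Y : Set X) : Prop :=
  ∃ A : ℕ → Set X, (∀ n, A n ∈ G) ∧ Y ⊆ ⋃ n, A n

/-- `C` contains configurations avoiding any given small set. -/
def Large {ι : Type*} (G : Set (Set X)) (C : Set (ι → X)) : Prop :=
  ∀ Z, Small G Z → ∃ x ∈ C, ∀ s, x s ∉ Z

/-- An action by finite modifications of `θ`. -/
def IsFlip (θ : X → ℕ → ℕ → Bool) (act : Finset (ℕ × ℕ) → X → X) : Prop :=
  ∀ γ x i m, θ (act γ x) i m = xor (θ x i m) (decide ((i, m) ∈ γ))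

lemma IsFlip.E3_act {θ : X → ℕ → ℕ → Bool} {act : Finset (ℕ × ℕ) → X → X}
    (h : IsFlip θ act) (γ : Finset (ℕ × ℕ)) (x : X) : E3 (θ x) (θ (act γ x)) := by
  intro k
  refine (γ.finite_toSet.image Prod.snd).subset fun m hm => ?_
  refine ⟨(k, m), ?_, rfl⟩
  by_contra hc
  refine hm ?_
  rw [h]
  simp only [Finset.mem_coe] at hc
  simp [hc]

lemma equivalence_sameHead (θ : X → ℕ → ℕ → Bool) (k : ℕ) : Equivalence (SameHead θ k) where
  refl _ := ⟨equivalence_E3.refl _, fun _ _ => rfl⟩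
  symm h := ⟨equivalence_E3.symm h.1, fun i hi => (h.2 i hi).symm⟩
  trans h h' := ⟨equivalence_E3.trans h.1 h'.1, fun i hi => (h.2 i hi).trans (h'.2 i hi)⟩

lemma Thin.mono {θ : X → ℕ → ℕ → Bool} {k j j' N : ℕ} {A : Set X} (h : Thin θ k j N A)
    (hj : j' ≤ j) : Thin θ k j' N A :=
  fun x hx y hy hxy i hi => h x hx y hy hxy i (hi.trans_le hj)

lemma Small.mono {G G' : Set (Set X)} {Y Y' : Set X} (h : Small G Y) (hG : G ⊆ G')
    (hY : Y' ⊆ Y) : Small G' Y' := by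
  obtain ⟨A, hA, hYA⟩ := h
  exact ⟨A, fun n => hG (hA n), hY.trans hYA⟩

lemma Small.of_mem {G : Set (Set X)} {A : Set X} (h : A ∈ G) : Small G A :=
  ⟨fun _ => A, fun _ => h, fun _ hx => Set.mem_iUnion.2 ⟨0, hx⟩⟩

lemma Small.iUnion {G : Set (Set X)} {ι : Type*} [Countable ι] [Nonempty ι] {Y : ι → Set X}
    (h : ∀ n, Small G (Y n)) : Small G (⋃ n, Y n) := by
  choose A hA hYA using h
  obtain ⟨e, he⟩ := exists_surjective_nat (ι × ℕ)
  refine ⟨fun n => A (e n).1 (e n).2, fun n => hA _ _, ?_⟩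
  refine Set.iUnion_subset fun i x hx => ?_
  obtain ⟨n, hn⟩ := Set.mem_iUnion.1 (hYA i hx)
  obtain ⟨m, hm⟩ := he (i, n)
  exact Set.mem_iUnion.2 ⟨m, by rw [hm]; exact hn⟩

lemma Small.union {G : Set (Set X)} {Y Z : Set X} (hY : Small G Y) (hZ : Small G Z) :
    Small G (Y ∪ Z) := by
  rw [Set.union_eq_iUnion]
  exact Small.iUnion (Bool.rec hZ hY)

lemma Small.exists_union {G H : Set (Set X)} (hG : ∅ ∈ G) (hH : ∅ ∈ H) {Z : Set X}
    (h : Small (G ∪ H) Z) : ∃ V W, Small G V ∧ Small H W ∧ Z ⊆ V ∪ W := by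
  classical
  obtain ⟨A, hA, hZ⟩ := h
  refine ⟨⋃ n, if A n ∈ G then A n else ∅, ⋃ n, if A n ∈ H then A n else ∅,
    ⟨_, fun n => ?_, subset_rfl⟩, ⟨_, fun n => ?_, subset_rfl⟩, fun x hx => ?_⟩
  · split_ifs with h
    exacts [h, hG]
  · split_ifs with h
    exacts [h, hH]
  · obtain ⟨n, hn⟩ := Set.mem_iUnion.1 (hZ hx)
    rcases hA n with h | h
    · exact Or.inl (Set.mem_iUnion.2 ⟨n, by rwa [if_pos h]⟩)
    · exact Or.inr (Set.mem_iUnion.2 ⟨n, by rwa [if_pos h]⟩)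

lemma Large.exists_inter {ι κ : Type*} [Countable κ] {G : Set (Set X)} {C : Set (ι → X)}
    (hG : ∅ ∈ G) (hC : Large G C) (D : κ → Set (ι → X)) (hD : C ⊆ ⋃ i, D i) :
    ∃ i, Large G (C ∩ D i) := by
  by_contra hcon
  simp only [Large, not_exists, not_forall, not_and] at hcon
  choose Z hZ hCZ using hcon
  have hsm : Small G (⋃ i, Z i) := by
    rcases isEmpty_or_nonempty κ with hκ | hκ
    · rw [Set.iUnion_of_empty]
      exact Small.of_mem hG
    · exact Small.iUnion hZ
  obtain ⟨x, hx, hxZ⟩ := hC _ hsm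
  obtain ⟨i, hi⟩ := Set.mem_iUnion.1 (hD hx)
  obtain ⟨s, hs⟩ := hCZ i x ⟨hx, hi⟩
  exact hxZ s (Set.mem_iUnion.2 ⟨i, not_not.1 hs⟩)

end Relations

section Measurability

variable {X : Type*} [MeasurableSpace X] {θ : X → ℕ → ℕ → Bool}

lemma measurableSet_apply_eq_apply (hθ : Measurable θ) (i m : ℕ) :
    MeasurableSet {p : X × X | θ p.1 i m = θ p.2 i m} := by
  have h : Measurable fun x => θ x i m := (measurable_pi_apply m).comp
    ((measurable_pi_apply i).comp hθ)
  exact measurableSet_eq_fun (h.comp measurable_fst) (h.comp measurable_snd)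

lemma measurableSet_finite_ne (hθ : Measurable θ) (i : ℕ) :
    MeasurableSet {p : X × X | {m | θ p.1 i m ≠ θ p.2 i m}.Finite} := by
  simp only [finite_setOf_ne_iff, Set.ofPred_exists, Set.ofPred_forall]
  exact .iUnion fun N => .iInter fun m => .iInter fun _ => measurableSet_apply_eq_apply hθ i m

lemma measurableSet_head (hθ : Measurable θ) (k : ℕ) :
    MeasurableSet {p : X × X | ∀ i < k, θ p.1 i = θ p.2 i} := by
  simp only [funext_iff, Set.ofPred_forall]
  exact .iInter fun i => .iInter fun _ => .iInter fun m => measurableSet_apply_eq_apply hθ i m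

lemma measurableSet_sameHead (hθ : Measurable θ) (k : ℕ) :
    MeasurableSet {p : X × X | SameHead θ k p.1 p.2} := by
  refine MeasurableSet.inter (s₁ := {p : X × X | E3 (θ p.1) (θ p.2)}) ?_ (measurableSet_head hθ k)
  simp only [E3, Set.ofPred_forall]
  exact .iInter fun i => measurableSet_finite_ne hθ i

lemma measurableSet_not_tail (hθ : Measurable θ) (j N : ℕ) :
    MeasurableSet {p : X × X | ¬ ∀ i < j, ∀ m ≥ N, θ p.1 i m = θ p.2 i m} := by
  refine MeasurableSet.compl (s := {p : X × X | ∀ i < j, ∀ m ≥ N, θ p.1 i m = θ p.2 i m}) ?_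
  simp only [Set.ofPred_forall]
  exact .iInter fun i => .iInter fun _ => .iInter fun m => .iInter fun _ =>
    measurableSet_apply_eq_apply hθ i m

end Measurability

section GoodSets

variable {X : Type*} [MeasurableSpace X] {θ : X → ℕ → ℕ → Bool}

lemma exists_E0_code {ι : Type*} [Countable ι] (q : ι → Set X) (hq : ∀ i, MeasurableSet (q i)) :
    ∃ ρ : X → ℕ → Bool, Measurable ρ ∧
      ∀ x y, E0 (ρ x) (ρ y) ↔ {i | ¬ (x ∈ q i ↔ y ∈ q i)}.Finite := by
  classical
  obtain ⟨e, he⟩ := exists_injective_nat ι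
  refine ⟨fun x n => decide (∃ i, e i = n ∧ x ∈ q i), ?_, fun x y => ?_⟩
  · refine measurable_pi_lambda _ fun n => ?_
    refine measurable_to_bool ?_
    have : (fun x => decide (∃ i, e i = n ∧ x ∈ q i)) ⁻¹' {true} =
        ⋃ i, ⋃ _ : e i = n, q i := by
      ext x
      simp
    rw [this]
    exact .iUnion fun i => .iUnion fun _ => hq i
  · have : {n : ℕ | decide (∃ i, e i = n ∧ x ∈ q i) ≠ decide (∃ i, e i = n ∧ y ∈ q i)} =
        e '' {i | ¬ (x ∈ q i ↔ y ∈ q i)} := by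
      ext n
      simp only [ne_eq, decide_eq_decide, Set.mem_ofPred_eq, Set.mem_image]
      constructor
      · intro h
        by_contra hc
        refine h ⟨?_, ?_⟩
        · rintro ⟨i, rfl, hi⟩
          refine ⟨i, rfl, ?_⟩
          by_contra hy
          exact hc ⟨i, fun h => hy (h.1 hi), rfl⟩
        · rintro ⟨i, rfl, hi⟩
          refine ⟨i, rfl, ?_⟩
          by_contra hy
          exact hc ⟨i, fun h => hy (h.2 hi), rfl⟩
      · rintro ⟨i, hi, rfl⟩ h
        refine hi ⟨fun hx => ?_, fun hy => ?_⟩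
        · obtain ⟨i', h', hy⟩ := h.1 ⟨i, rfl, hx⟩
          exact he h' ▸ hy
        · obtain ⟨i', h', hx⟩ := h.2 ⟨i, rfl, hy⟩
          exact he h' ▸ hx
    rw [E0, this, Set.finite_image_iff he.injOn]

lemma good_empty : Good θ ∅ :=
  ⟨.empty, fun _ _ _ h => h.elim, fun _ _ => false, measurable_const, fun _ h => h.elim⟩

lemma Good.iUnion {B : ℕ → Set X} (hB : ∀ n, Good θ (B n)) : Good θ (⋃ n, B n) := by
  choose hBm hBE ρ hρm hρ using hB
  have hDE : ∀ n x y, E3 (θ x) (θ y) → x ∈ disjointed B n → y ∈ disjointed B n := by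
    intro n x y hxy hx
    rw [disjointed_eq_inter_compl] at hx ⊢
    simp only [Set.mem_inter_iff, Set.mem_iInter, Set.mem_compl_iff] at hx ⊢
    exact ⟨hBE n x y hxy hx.1, fun i hi hy => hx.2 i hi (hBE i y x (equivalence_E3.symm hxy) hy)⟩
  let q : (ℕ × ℕ) ⊕ (ℕ × ℕ) → Set X := Sum.elim (fun p => disjointed B p.1)
    fun p => disjointed B p.1 ∩ {x | ρ p.1 x p.2 = true}
  have hq : ∀ i, MeasurableSet (q i) := by
    rintro (⟨i, n⟩ | ⟨i, n⟩)
    · exact MeasurableSet.disjointed hBm i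
    · exact (MeasurableSet.disjointed hBm i).inter
        (measurableSet_eq_fun ((measurable_pi_apply n).comp (hρm i)) measurable_const)
  obtain ⟨σ, hσm, hσ⟩ := exists_E0_code q hq
  refine ⟨.iUnion hBm, fun x y hxy hx => ?_, σ, hσm, fun x hx y hy => ?_⟩
  · obtain ⟨n, hn⟩ := Set.mem_iUnion.1 hx
    exact Set.mem_iUnion.2 ⟨n, hBE n x y hxy hn⟩
  rw [hσ]
  rw [← iUnion_disjointed] at hx hy
  obtain ⟨n, hn⟩ := Set.mem_iUnion.1 hx
  obtain ⟨m, hm⟩ := Set.mem_iUnion.1 hy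
  have huniq : ∀ {z a b}, z ∈ disjointed B a → z ∈ disjointed B b → a = b := by
    intro z a b ha hb
    by_contra hab
    exact Set.disjoint_left.1 (disjoint_disjointed B hab) ha hb
  by_cases hnm : n = m
  · subst hnm
    rw [hρ n x (disjointed_subset B n hn) y (disjointed_subset B n hm), E0]
    have : {i | ¬ (x ∈ q i ↔ y ∈ q i)} =
        (fun l => Sum.inr (n, l)) '' {l | ρ n x l ≠ ρ n y l} := by
      ext i
      rcases i with ⟨i, l⟩ | ⟨i, l⟩
      · have : x ∈ disjointed B i ↔ y ∈ disjointed B i :=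
          ⟨fun h => huniq hn h ▸ hm, fun h => huniq hm h ▸ hn⟩
        simp [q, this]
      · by_cases hi : n = i
        · subst hi
          cases h : ρ n x l <;> cases h' : ρ n y l <;> simp [q, hn, hm, h, h']
        · have h1 : x ∉ disjointed B i := fun h => hi (huniq hn h)
          have h2 : y ∉ disjointed B i := fun h => hi (huniq hm h)
          simp [q, h1, h2, hi]
    rw [this, Set.finite_image_iff]
    intro a _ b _ hab
    simpa using hab
  · refine iff_of_false (fun h => hnm (huniq (hDE n x y h hn) hm)) fun h => ?_
    refine (Set.infinite_range_of_injective
      (f := fun l : ℕ => (Sum.inl (n, l) : (ℕ × ℕ) ⊕ (ℕ × ℕ))) ?_) (h.subset ?_)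
    · intro a b hab
      simpa using hab
    · rintro _ ⟨l, rfl⟩
      have h2 : y ∉ disjointed B n := fun h => hnm (huniq h hm)
      simp [q, hn, h2]

end GoodSets

section Reduction

variable {X : Type*} [MeasurableSpace X] {θ : X → ℕ → ℕ → Bool}

/-- If `SameHead θ k` is smooth on the invariant Borel set `W`, as witnessed by a sequence of
invariant Borel sets, then `W` is contained in a good set. -/
lemma exists_good_superset (hθ : Measurable θ) {act : Finset (ℕ × ℕ) → X → X}
    (hact : ∀ γ, Measurable (act γ)) (hflip : IsFlip θ act) (k : ℕ) {W : Set X}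
    (hW : MeasurableSet W) (hWS : ∀ x y, SameHead θ k x y → x ∈ W → y ∈ W) (q : ℕ → Set X)
    (hq : ∀ n, MeasurableSet (q n)) (hqS : ∀ n x y, SameHead θ k x y → x ∈ q n → y ∈ q n)
    (hqW : ∀ x ∈ W, ∀ y ∈ W, (∀ i < k, θ x i = θ y i) → (∀ n, x ∈ q n ↔ y ∈ q n) →
      E3 (θ x) (θ y)) :
    ∃ B, Good θ B ∧ W ⊆ B := by
  classical
  let V : ℕ → Type := fun N => (Fin k → Fin N → Bool) × (Fin N → Prop)
  let box : ℕ → Finset (ℕ × ℕ) := fun N => Finset.range k ×ˢ Finset.range N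
  let r : (Σ N, V N) ⊕ (Fin k × ℕ) → Set X := Sum.elim
    (fun v => {x | ∃ γ ⊆ box v.1, act γ x ∈ W ∧
      (∀ (i : Fin k) (m : Fin v.1), θ (act γ x) i m = v.2.1 i m) ∧
      ∀ n : Fin v.1, act γ x ∈ q n ↔ v.2.2 n})
    (fun p => {x | θ x p.1 p.2 = true})
  have hθa : ∀ i m, Measurable fun x => θ x i m := fun i m =>
    (measurable_pi_apply m).comp ((measurable_pi_apply i).comp hθ)
  have hr : ∀ v, MeasurableSet (r v) := by
    rintro (⟨N, σ, τ⟩ | ⟨i, m⟩)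
    · have : r (Sum.inl ⟨N, σ, τ⟩) = ⋃ γ : Finset (ℕ × ℕ), ⋃ _ : γ ⊆ box N,
          act γ ⁻¹' (W ∩ ((⋂ (i : Fin k) (m : Fin N), {x | θ x i m = σ i m}) ∩
            ⋂ n : Fin N, {x | x ∈ q n ↔ τ n})) := by
        ext x
        simp only [r, Sum.elim_inl, Set.mem_ofPred_eq, Set.mem_iUnion, Set.mem_preimage,
          Set.mem_inter_iff, Set.mem_iInter, exists_prop]
      rw [this]
      refine .iUnion fun γ => .iUnion fun _ => hact γ (hW.inter (.inter ?_ ?_))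
      · exact .iInter fun i => .iInter fun m => measurableSet_eq_fun (hθa i m) measurable_const
      · refine .iInter fun n => ?_
        by_cases hn : τ n
        · simpa [hn] using hq n
        · convert (hq n).compl using 1
          ext x
          simp [hn]
    · exact measurableSet_eq_fun (hθa i m) measurable_const
  have : ∀ N, Finite (V N) := fun N => inferInstanceAs (Finite (_ × _))
  obtain ⟨ρ, hρm, hρ⟩ := exists_E0_code r hr
  have hSact : ∀ {x y : X} {γ δ : Finset (ℕ × ℕ)}, E3 (θ x) (θ y) →
      (∀ i < k, θ (act γ x) i = θ (act δ y) i) → SameHead θ k (act γ x) (act δ y) := by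
    intro x y γ δ hxy h
    exact ⟨equivalence_E3.trans (equivalence_E3.symm (hflip.E3_act γ x))
      (equivalence_E3.trans hxy (hflip.E3_act δ y)), h⟩
  have hqS' : ∀ {n x y}, SameHead θ k x y → (x ∈ q n ↔ y ∈ q n) := fun h =>
    ⟨hqS _ _ _ h, hqS _ _ _ ((equivalence_sameHead θ k).symm h)⟩
  have htransfer : ∀ {x y : X}, E3 (θ x) (θ y) → ∀ N, (∀ i < k, ∀ m ≥ N, θ x i m = θ y i m) →
      ∀ γ : Finset (ℕ × ℕ), ∃ δ : Finset (ℕ × ℕ), (∀ M ≥ N, γ ⊆ box M → δ ⊆ box M) ∧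
        SameHead θ k (act γ x) (act δ y) := by
    intro x y hxy N hN γ
    refine ⟨symmDiff γ ((box N).filter fun p => θ x p.1 p.2 ≠ θ y p.1 p.2), ?_, hSact hxy ?_⟩
    · intro M hM hγ p hp
      rcases Finset.mem_symmDiff.1 hp with h | h
      · exact hγ h.1
      · have := (Finset.mem_filter.1 h.1).1
        simp only [box, Finset.mem_product, Finset.mem_range] at this ⊢
        omega
    · intro i hi
      funext m
      rw [hflip, hflip]
      by_cases hm : m < N
      · by_cases hγ : (i, m) ∈ γ <;> cases hx : θ x i m <;> cases hy : θ y i m <;>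
          simp [Finset.mem_symmDiff, box, hi, hm, hγ, hx, hy]
      · by_cases hγ : (i, m) ∈ γ <;> simp [Finset.mem_symmDiff, box, hm, hγ, hN i hi m (by omega)]
  have hrsub : ∀ {x y : X}, E3 (θ x) (θ y) → ∀ N, (∀ i < k, ∀ m ≥ N, θ x i m = θ y i m) →
      ∀ M ≥ N, ∀ v : V M, x ∈ r (Sum.inl ⟨M, v⟩) → y ∈ r (Sum.inl ⟨M, v⟩) := by
    rintro x y hxy N hN M hM v ⟨γ, hγ, hγW, hγσ, hγτ⟩
    obtain ⟨δ, hδ, hS⟩ := htransfer hxy N hN γ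
    refine ⟨δ, hδ M hM hγ, hWS _ _ hS hγW, fun i m => ?_, fun n => (hqS' hS).symm.trans (hγτ n)⟩
    rw [← hS.2 i i.2]
    exact hγσ i m
  refine ⟨⋃ γ, act γ ⁻¹' W, ⟨.iUnion fun γ => hact γ hW, ?_, ρ, hρm, ?_⟩, ?_⟩
  · intro x y hxy hx
    obtain ⟨γ, hγ⟩ := Set.mem_iUnion.1 hx
    obtain ⟨N, hN⟩ := exists_forall_ge_eq hxy k
    obtain ⟨δ, -, hS⟩ := htransfer hxy N hN γ
    exact Set.mem_iUnion.2 ⟨δ, hWS _ _ hS hγ⟩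
  · intro x hx y hy
    rw [hρ]
    constructor
    · intro hxy
      obtain ⟨N, hN⟩ := exists_forall_ge_eq hxy k
      have hfin : (Set.range (fun v : Σ M : Fin N, V M => (⟨v.1, v.2⟩ : Σ M, V M))).Finite :=
        Set.finite_range _
      refine ((hfin.image Sum.inl).union ((Set.finite_range
        (fun p : Fin k × Fin N => (p.1, (p.2 : ℕ)))).image Sum.inr)).subset ?_
      rintro (⟨M, v⟩ | ⟨i, m⟩) h
      · refine Or.inl ⟨⟨M, v⟩, ?_, rfl⟩
        have hM : M < N := by
          by_contra hM
          exact h ⟨hrsub hxy N hN M (by omega) v, hrsub (equivalence_E3.symm hxy) N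
            (fun i hi m hm => (hN i hi m hm).symm) M (by omega) v⟩
        exact ⟨⟨⟨M, hM⟩, v⟩, rfl⟩
      · refine Or.inr ⟨⟨i, m⟩, ?_, rfl⟩
        have hm : m < N := by
          by_contra hm
          refine h ?_
          simp [r, hN i i.2 m (by omega)]
        exact ⟨(i, ⟨m, hm⟩), rfl⟩
    · intro hfin
      obtain ⟨N, hN⟩ : ∃ N, (∀ M ≥ N, ∀ v : V M, x ∈ r (Sum.inl ⟨M, v⟩) ↔ y ∈ r (Sum.inl ⟨M, v⟩)) ∧
          ∀ i < k, ∀ m ≥ N, θ x i m = θ y i m := by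
        obtain ⟨N, hN⟩ := (hfin.image (Sum.elim (fun v => v.1) fun p => p.2)).bddAbove
        refine ⟨N + 1, fun M hM v => ?_, fun i hi m hm => ?_⟩
        · by_contra h
          have : M ≤ N := hN ⟨Sum.inl ⟨M, v⟩, h, rfl⟩
          omega
        · by_contra h
          have : m ≤ N := hN ⟨Sum.inr (⟨i, hi⟩, m), fun hc => h (Bool.eq_iff_iff.2 hc), rfl⟩
          omega
      obtain ⟨γ', hγ'⟩ := Set.mem_iUnion.1 hx
      obtain ⟨γ, K, hγK, hγW⟩ : ∃ γ : Finset (ℕ × ℕ), ∃ K, γ ⊆ box K ∧ act γ x ∈ W := by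
        refine ⟨γ'.filter fun p => p.1 < k, γ'.sup Prod.snd + 1, ?_, hWS _ _ (hSact
          (equivalence_E3.refl _) ?_) hγ'⟩
        · intro p hp
          obtain ⟨hp, hpk⟩ := Finset.mem_filter.1 hp
          have := Finset.le_sup (f := Prod.snd) hp
          simp only [box, Finset.mem_product, Finset.mem_range]
          omega
        · intro i hi
          funext m
          simp [hflip _ _ _ _, hi]
      have hbox : ∀ {M M'}, M ≤ M' → box M ⊆ box M' := fun h =>
        Finset.product_subset_product_right (Finset.range_subset_range.2 h)
      have key : ∀ M ≥ max N K, ∃ δ, act δ y ∈ W ∧ (∀ i < k, θ (act γ x) i = θ (act δ y) i) ∧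
          ∀ n < M, act γ x ∈ q n ↔ act δ y ∈ q n := by
        intro M hM
        obtain ⟨δ, hδ, hδW, hδσ, hδτ⟩ := (hN.1 M (le_of_max_le_left hM)
          (fun i m => θ (act γ x) i m, fun n => act γ x ∈ q n)).1
          ⟨γ, hγK.trans (hbox (le_of_max_le_right hM)), hγW, fun _ _ => rfl, fun _ => Iff.rfl⟩
        refine ⟨δ, hδW, fun i hi => funext fun m => ?_, fun n hn => (hδτ ⟨n, hn⟩).symm⟩
        by_cases hm : m < M
        · exact (hδσ ⟨i, hi⟩ ⟨m, hm⟩).symm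
        · have h1 : (i, m) ∉ γ := fun h => by
            have := hγK.trans (hbox (le_of_max_le_right hM)) h
            simp only [box, Finset.mem_product, Finset.mem_range] at this
            omega
          have h2 : (i, m) ∉ δ := fun h => by
            have := hδ h
            simp only [box, Finset.mem_product, Finset.mem_range] at this
            omega
          have : m ≥ N := by omega
          simp [hflip _ _ _ _, h1, h2, hN.2 i hi m this]
      obtain ⟨δ, hδW, hδ, -⟩ := key _ le_rfl
      have := hqW _ hγW _ hδW hδ fun n => by
        obtain ⟨δ', -, hδ', hn⟩ := key (max (max N K) (n + 1)) (le_max_left _ _)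
        refine (hn n (by omega)).trans (hqS' (hSact (equivalence_E3.refl _) fun i hi => ?_))
        rw [← hδ' i hi, hδ i hi]
      exact equivalence_E3.trans (hflip.E3_act γ x)
        (equivalence_E3.trans this (equivalence_E3.symm (hflip.E3_act δ y)))
  · intro x hx
    refine Set.mem_iUnion.2 ⟨∅, hWS _ _ ⟨hflip.E3_act ∅ x, fun i _ => funext fun m => ?_⟩ hx⟩
    simp [hflip _ _ _ _]

end Reduction

section Ideals

variable {X : Type*} [MeasurableSpace X] {θ : X → ℕ → ℕ → Bool}

lemma empty_mem_thinSets (k j : ℕ) : ∅ ∈ thinSets θ k j :=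
  ⟨.empty, 0, fun _ h => h.elim⟩

/-- The configuration obtained by fixing the last bit to be `b`. -/
def half {n : ℕ} (b : Bool) (x : (Fin (n + 1) → Bool) → X) (s : Fin n → Bool) : X :=
  x (Fin.snoc (α := fun _ => Bool) s b)

/-- The configurations whose halves lie in `C` and have base points in the same class of
`SameHead θ k`, but different tails beyond `N`. -/
def joinSet (θ : X → ℕ → ℕ → Bool) (k j N : ℕ) {n : ℕ} (C : Set ((Fin n → Bool) → X)) :
    Set ((Fin (n + 1) → Bool) → X) :=
  {x | (half false x ∈ C ∧ half true x ∈ C) ∧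
    SameHead θ k (half false x fun _ => false) (half true x fun _ => false) ∧
    ¬ ∀ i < j, ∀ m ≥ N, θ (half false x fun _ => false) i m = θ (half true x fun _ => false) i m}

lemma measurableSet_joinSet (hθ : Measurable θ) (k j N : ℕ) {n : ℕ}
    {C : Set ((Fin n → Bool) → X)} (hC : MeasurableSet C) :
    MeasurableSet (joinSet θ k j N C) := by
  have hh : ∀ b, Measurable (half (X := X) (n := n) b) := fun b =>
    measurable_pi_lambda _ fun s => measurable_pi_apply _
  have hb : Measurable fun x : (Fin (n + 1) → Bool) → X =>
      (half false x fun _ => false, half true x fun _ => false) :=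
    (measurable_pi_apply _).prodMk (measurable_pi_apply _)
  exact ((hh false hC).inter (hh true hC)).inter
    ((hb (measurableSet_sameHead hθ k)).inter (hb (measurableSet_not_tail hθ j N)))

variable [TopologicalSpace X] [PolishSpace X] [BorelSpace X]

/-- A set that is small with respect to every family of thin sets at level `k` is contained in a
good set. -/
lemma exists_good_superset_of_small_thinSets (hθ : Measurable θ) {act : Finset (ℕ × ℕ) → X → X}
    (hact : ∀ γ, Measurable (act γ)) (hflip : IsFlip θ act) (k : ℕ) {Y : Set X}
    (hY : ∀ j, Small (thinSets θ k j) Y) : ∃ B, Good θ B ∧ Y ⊆ B := by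
  have hS := equivalence_sameHead θ k
  have hSm := measurableSet_sameHead hθ k
  have hθa : ∀ i m b, MeasurableSet {x | θ x i m = b} := fun i m b =>
    measurableSet_eq_fun ((measurable_pi_apply m).comp ((measurable_pi_apply i).comp hθ))
      measurable_const
  choose A hA hYA using hY
  choose hAm N hN using hA
  have hQ : ∀ p : ℕ × ℕ × ℕ × ℕ, ∃ Q : Set X, MeasurableSet Q ∧
      (∀ x y, SameHead θ k x y → x ∈ Q → y ∈ Q) ∧
      (p.2.2.1 < p.1 → N p.1 p.2.1 ≤ p.2.2.2 →
        ∀ x ∈ A p.1 p.2.1, x ∈ Q ↔ θ x p.2.2.1 p.2.2.2 = true) := by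
    rintro ⟨j, i, a, m⟩
    by_cases h : a < j ∧ N j i ≤ m
    · obtain ⟨Q, hQm, hQS, hPQ, hQ⟩ := exists_invariant_separation hS hSm
        ((hAm j i).inter (hθa a m true)).analyticSet
        ((hAm j i).inter (hθa a m false)).analyticSet (by
          rintro x ⟨hx, hxt⟩ y ⟨hy, hyt⟩ hxy
          have h1 := hN j i x hx y hy hxy a h.1 m h.2
          have h2 : θ x a m = true := hxt
          have h3 : θ y a m = false := hyt
          simp [h2, h3] at h1)
      refine ⟨Q, hQm, hQS, fun _ _ x hx => ⟨fun hxQ => ?_, fun hxt => hPQ ⟨hx, hxt⟩⟩⟩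
      by_contra hne
      exact hQ x ⟨hx, Bool.eq_false_iff.2 hne⟩ hxQ
    · exact ⟨∅, .empty, fun _ _ _ h => h, fun h1 h2 => (h ⟨h1, h2⟩).elim⟩
  choose Q hQm hQS hQ using hQ
  have hQS' : ∀ {p x y}, SameHead θ k x y → (x ∈ Q p ↔ y ∈ Q p) := fun h =>
    ⟨hQS _ _ _ h, hQS _ _ _ (hS.symm h)⟩
  let R : ℕ → X → X → Prop := fun j x y => (∀ p, x ∈ Q p ↔ y ∈ Q p) ∧
    (∀ i < k, θ x i = θ y i) ∧ ¬ ∀ a < j, {m | θ x a m ≠ θ y a m}.Finite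
  have hRm : ∀ j, MeasurableSet {p : X × X | R j p.1 p.2} := by
    intro j
    refine MeasurableSet.inter (s₁ := {p : X × X | ∀ q, p.1 ∈ Q q ↔ p.2 ∈ Q q}) ?_
      ((measurableSet_head hθ k).inter (MeasurableSet.compl
        (s := {p : X × X | ∀ a < j, {m | θ p.1 a m ≠ θ p.2 a m}.Finite}) ?_))
    · rw [Set.ofPred_forall]
      refine .iInter fun q => ?_
      exact MeasurableSet.iff (measurable_fst (hQm q)) (measurable_snd (hQm q))
    · simp only [Set.ofPred_forall]
      exact .iInter fun a => .iInter fun _ => measurableSet_finite_ne hθ a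
  have hB : ∀ j i, ∃ B : Set X, MeasurableSet B ∧ (∀ x y, SameHead θ k x y → x ∈ B → y ∈ B) ∧
      A j i ⊆ B ∧ ∀ x ∈ B, ∀ y ∈ B, ¬ R j x y := by
    intro j i
    refine exists_invariant_independent_superset hS hSm (hRm j) ?_ ?_ (hAm j i).analyticSet ?_
    · rintro x y ⟨h1, h2, h3⟩
      refine ⟨fun p => (h1 p).symm, fun i hi => (h2 i hi).symm, fun h => h3 fun a ha => ?_⟩
      simpa only [ne_comm] using h a ha
    · rintro x y z ⟨h1, h2, h3⟩ hyz
      refine ⟨fun p => (h1 p).trans (hQS' hyz), fun i hi => (h2 i hi).trans (hyz.2 i hi),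
        fun h => h3 fun a ha => ((h a ha).union (hyz.1 a)).subset fun m hm => ?_⟩
      by_contra hc
      simp only [Set.mem_union, Set.mem_ofPred_eq, not_or, not_not] at hc
      exact hm (hc.1.trans hc.2.symm)
    · rintro x hx y hy ⟨h1, h2, h3⟩
      refine h3 fun a ha => finite_setOf_ne_iff.2 ⟨N j i, fun m hm => ?_⟩
      rw [Bool.eq_iff_iff, ← hQ (j, i, a, m) ha hm x hx, ← hQ (j, i, a, m) ha hm y hy]
      exact h1 _
  choose B hBm hBS hAB hBR using hB
  obtain ⟨e, he⟩ := exists_surjective_nat ((ℕ × ℕ × ℕ × ℕ) ⊕ (ℕ × ℕ))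
  obtain ⟨D, hD, hWD⟩ := exists_good_superset hθ hact hflip k (W := ⋂ j, ⋃ i, B j i)
    (.iInter fun j => .iUnion fun i => hBm j i)
    (fun x y hxy hx => Set.mem_iInter.2 fun j => by
      obtain ⟨i, hi⟩ := Set.mem_iUnion.1 (Set.mem_iInter.1 hx j)
      exact Set.mem_iUnion.2 ⟨i, hBS j i x y hxy hi⟩)
    (fun n => Sum.elim Q (fun p : ℕ × ℕ => B p.1 p.2) (e n))
    (fun n => by rcases e n with p | p; exacts [hQm p, hBm p.1 p.2])
    (fun n => by rcases e n with p | p; exacts [hQS p, hBS p.1 p.2])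
    (fun x hx y hy hxy hq a => by
      obtain ⟨i, hi⟩ := Set.mem_iUnion.1 (Set.mem_iInter.1 hx (a + 1))
      have hq' : ∀ p, x ∈ Sum.elim Q (fun p : ℕ × ℕ => B p.1 p.2) p ↔
          y ∈ Sum.elim Q (fun p : ℕ × ℕ => B p.1 p.2) p := fun p => by
        obtain ⟨n, rfl⟩ := he p
        exact hq n
      have hR := hBR (a + 1) i x hi y ((hq' (Sum.inr (a + 1, i))).1 hi)
      by_contra hne
      exact hR ⟨fun p => hq' (Sum.inl p), hxy, fun h => hne (h a (Nat.lt_succ_self a))⟩)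
  refine ⟨D, hD, fun x hx => hWD (Set.mem_iInter.2 fun j => ?_)⟩
  obtain ⟨i, hi⟩ := Set.mem_iUnion.1 (hYA j hx)
  exact Set.mem_iUnion.2 ⟨i, hAB j i hi⟩

/-- A large set of finite configurations remains large when the thin sets of some level `(k, j)`
are added to the ideal. -/
lemma Large.exists_union_thinSets (hθ : Measurable θ) {act : Finset (ℕ × ℕ) → X → X}
    (hact : ∀ γ, Measurable (act γ)) (hflip : IsFlip θ act) (k : ℕ) {G : Set (Set X)}
    (hG : ∀ B, Good θ B → B ∈ G) {ι : Type*} [Finite ι] {C : Set (ι → X)} (hC : Large G C) :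
    ∃ j, Large (G ∪ thinSets θ k j) C := by
  by_contra hcon
  simp only [Large, not_exists, not_forall, not_and] at hcon
  choose Z hZ hCZ using hcon
  have hsplit := fun j => (hZ j).exists_union (hG _ good_empty) (empty_mem_thinSets k j)
  choose V W hV hW hZVW using hsplit
  obtain ⟨B, hB, hWB⟩ := exists_good_superset_of_small_thinSets hθ hact hflip k
    (Y := ⋂ j, ⋃ i, W (j + i)) fun j => by
      refine Small.mono (G := thinSets θ k j) (Small.iUnion fun i => ?_) subset_rfl
        (Set.iInter_subset _ j)
      exact (hW (j + i)).mono (fun A hA => ⟨hA.1, hA.2.imp fun N h => h.mono (by omega)⟩)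
        subset_rfl
  obtain ⟨x, hx, hxZ⟩ := hC _ ((Small.iUnion hV).union (Small.of_mem (hG B hB)))
  have hs : ∀ j, ∃ s, x s ∈ W j := by
    intro j
    obtain ⟨s, hs⟩ := hCZ j x hx
    refine ⟨s, (hZVW j (not_not.1 hs)).resolve_left fun h => ?_⟩
    exact hxZ s (Or.inl (Set.mem_iUnion.2 ⟨j, h⟩))
  choose s hs using hs
  obtain ⟨t, ht⟩ := Finite.exists_infinite_fiber s
  refine hxZ t (Or.inr (hWB (Set.mem_iInter.2 fun j => ?_)))
  obtain ⟨i, hi, hji⟩ := (Set.infinite_coe_iff.1 ht).exists_gt j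
  have hi' : s i = t := hi
  refine Set.mem_iUnion.2 ⟨i - j, ?_⟩
  rw [show j + (i - j) = i by omega, ← hi']
  exact hs i

lemma Large.joinSet (hθ : Measurable θ) {k j N : ℕ} {G : Set (Set X)}
    (hG : ∀ A ∈ G, MeasurableSet A) (hT : thinSets θ k j ⊆ G) {n : ℕ}
    {C : Set ((Fin n → Bool) → X)} (hCm : MeasurableSet C) (hC : Large G C) :
    Large G (joinSet θ k j N C) := by
  rintro Z ⟨A, hA, hZA⟩
  by_contra! hcon
  have hAm : MeasurableSet (⋃ n, A n) := .iUnion fun n => hG _ (hA n)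
  let C' : Set ((Fin n → Bool) → X) := C ∩ ⋂ s, (fun x => x s) ⁻¹' (⋃ n, A n)ᶜ
  have hC' : MeasurableSet C' := hCm.inter (.iInter fun s => measurable_pi_apply s hAm.compl)
  have hthin : Thin θ k j N ((fun x => x fun _ => false) '' C') := by
    rintro _ ⟨x, ⟨hx, hxA⟩, rfl⟩ _ ⟨y, ⟨hy, hyA⟩, rfl⟩ hxy
    by_contra hne
    let z : (Fin (n + 1) → Bool) → X := fun s =>
      cond (s (Fin.last n)) (y fun i => s i.castSucc) (x fun i => s i.castSucc)
    have h0 : half false z = x := by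
      funext s
      simp [half, z]
    have h1 : half true z = y := by
      funext s
      simp [half, z]
    obtain ⟨s, hs⟩ := hcon z ⟨⟨h0 ▸ hx, h1 ▸ hy⟩, by rw [h0, h1]; exact hxy,
      by rw [h0, h1]; exact hne⟩
    have hs' := hZA hs
    simp only [z] at hs'
    cases h : s (Fin.last n) with
    | false => exact Set.mem_iInter.1 hxA _ (by simpa [h] using hs')
    | true => exact Set.mem_iInter.1 hyA _ (by simpa [h] using hs')
  have hRm : MeasurableSet {p : X × X | SameHead θ k p.1 p.2 ∧
      ¬ ∀ i < j, ∀ m ≥ N, θ p.1 i m = θ p.2 i m} :=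
    (measurableSet_sameHead hθ k).inter (measurableSet_not_tail hθ j N)
  obtain ⟨B, hBm, -, hAB, hBR⟩ := exists_invariant_independent_superset
    (R := fun x y => SameHead θ k x y ∧ ¬ ∀ i < j, ∀ m ≥ N, θ x i m = θ y i m) eq_equivalence
    measurableSet_diagonal hRm
    (fun x y h => ⟨(equivalence_sameHead θ k).symm h.1, fun h' => h.2 fun i hi m hm =>
      (h' i hi m hm).symm⟩)
    (fun x y z h hyz => hyz ▸ h)
    (hC'.analyticSet_image (measurable_pi_apply _))
    (fun x hx y hy h => h.2 (hthin x hx y hy h.1))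
  have hBG : B ∈ G := hT ⟨hBm, N, fun x hx y hy hxy => by
    by_contra hne
    exact hBR x hx y hy ⟨hxy, hne⟩⟩
  obtain ⟨x, hx, hxZ⟩ := hC _ (Small.union ⟨A, hA, subset_rfl⟩ (Small.of_mem hBG))
  refine hxZ (fun _ => false) (Or.inr (hAB ⟨x, ⟨hx, ?_⟩, rfl⟩))
  exact Set.mem_iInter.2 fun s h => hxZ s (Or.inl h)

end Ideals

section Fusion

variable {X : Type*} {θ : X → ℕ → ℕ → Bool}

lemma apply_eq_half {n : ℕ} (x : (Fin (n + 1) → Bool) → X) (s : Fin (n + 1) → Bool) :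
    x s = half (s (Fin.last n)) x fun i => s i.castSucc := by
  refine congrArg x (funext fun i => ?_)
  refine Fin.lastCases ?_ (fun i => ?_) i <;> simp

lemma exists_mem_apply_eq {C : (n : ℕ) → Set ((Fin n → Bool) → X)}
    (hhalf : ∀ n, ∀ x ∈ C (n + 1), ∀ b, half b x ∈ C n) (c : ℕ → Bool) {n m : ℕ} (hnm : n ≤ m)
    {x : (Fin m → Bool) → X} (hx : x ∈ C m) :
    ∃ y ∈ C n, y (fun p => c p) = x fun p => c p := by
  induction m, hnm using Nat.le_induction with
  | base => exact ⟨x, hx, rfl⟩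
  | succ m hnm ih =>
    obtain ⟨y, hy, hyx⟩ := ih (hhalf m x hx (c m))
    exact ⟨y, hy, hyx.trans (apply_eq_half x fun p => c p).symm⟩

lemma exists_forall_ge_unpair (a N : ℕ) :
    ∃ n₀, ∀ p ≥ n₀, (Nat.unpair p).1 ≤ a → N ≤ (Nat.unpair p).2 := by
  refine ⟨(max a N + 1) ^ 2, fun p hp ha => ?_⟩
  by_contra! hN
  have h1 := Nat.pair_lt_max_add_one_sq (Nat.unpair p).1 (Nat.unpair p).2
  rw [Nat.pair_unpair] at h1
  have h2 : max (Nat.unpair p).1 (Nat.unpair p).2 ≤ max a N := max_le_max ha hN.le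
  have h3 : (max (Nat.unpair p).1 (Nat.unpair p).2 + 1) ^ 2 ≤ (max a N + 1) ^ 2 :=
    Nat.pow_le_pow_left (by omega) 2
  omega

lemma tail_eq_of_agree {C : (n : ℕ) → Set ((Fin n → Bool) → X)}
    (hhalf : ∀ n, ∀ x ∈ C (n + 1), ∀ b, half b x ∈ C n)
    (hhead : ∀ n, ∀ x ∈ C (n + 1), ∀ s, ∀ a < (Nat.unpair n).1,
      θ (half false x s) a = θ (half true x s) a)
    {a M n₀ : ℕ} (hM : ∀ x ∈ C n₀, ∀ s t, ∀ m ≥ M, θ (x s) a m = θ (x t) a m)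
    {n : ℕ} (hn : n₀ ≤ n) : ∀ x ∈ C n, ∀ s t : Fin n → Bool,
      (∀ p : Fin n, n₀ ≤ p → (Nat.unpair p).1 ≤ a → s p = t p) →
      ∀ m ≥ M, θ (x s) a m = θ (x t) a m := by
  induction n, hn using Nat.le_induction with
  | base => exact fun x hx s t _ => hM x hx s t
  | succ n hn ih =>
    intro x hx s t hst m hm
    rw [apply_eq_half x s, apply_eq_half x t]
    have h1 := ih _ (hhalf n x hx (s (Fin.last n))) (fun i => s i.castSucc) (fun i => t i.castSucc)
      (fun p hp hpa => hst p.castSucc hp hpa) m hm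
    rw [h1]
    by_cases ha : a < (Nat.unpair n).1
    · have h2 := congrFun (hhead n x hx (fun i => t i.castSucc) a ha) m
      cases s (Fin.last n) <;> cases t (Fin.last n) <;> simp [h2]
    · rw [hst (Fin.last n) hn (not_lt.1 ha)]

/-- A fusion sequence of configurations yields a Borel reduction of `E3`. -/
lemma exists_reduction_of_fusion [MetricSpace X] [CompleteSpace X] [MeasurableSpace X]
    [BorelSpace X] (hθ : Continuous θ) {C : (n : ℕ) → Set ((Fin n → Bool) → X)}
    (hne : ∀ n, (C n).Nonempty)
    (hhalf : ∀ n, ∀ x ∈ C (n + 1), ∀ b, half b x ∈ C n)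
    (hdist : ∀ n, ∀ x ∈ C n, ∀ y ∈ C n, ∀ s, dist (x s) (y s) ≤ (1 / 2) ^ n)
    {i l j : ℕ → ℕ} {v : ℕ → Bool}
    (hi : ∀ n, i n < j (Nat.unpair n).1) (hl : ∀ n, n ≤ l n)
    (hcode : ∀ n, ∀ x ∈ C (n + 1), ∀ s, θ (x s) (i n) (l n) = xor (v n) (s (Fin.last n)))
    (hhead : ∀ n, ∀ x ∈ C (n + 1), ∀ s, ∀ a < (Nat.unpair n).1,
      θ (half false x s) a = θ (half true x s) a)
    (htail : ∀ n, ∃ M, ∀ x ∈ C n, ∀ s t, ∀ a ≤ n, ∀ m ≥ M, θ (x s) a m = θ (x t) a m) :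
    ∃ φ : (ℕ → ℕ → Bool) → X, Measurable φ ∧ ∀ w w', E3 w w' ↔ E3 (θ (φ w)) (θ (φ w')) := by
  choose u hu using hne
  have hlim : ∀ c : ℕ → Bool, ∃ z, Filter.Tendsto (fun n => u n fun p => c p) Filter.atTop
      (nhds z) := by
    refine fun c => cauchySeq_tendsto_of_complete
      (cauchySeq_of_le_tendsto_0 (fun n => (1 / 2 : ℝ) ^ n) (fun n m N hn hm => ?_)
        (tendsto_pow_atTop_nhds_zero_of_lt_one (by norm_num) (by norm_num)))
    obtain ⟨x, hx, hxn⟩ := exists_mem_apply_eq hhalf c hn (hu n)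
    obtain ⟨y, hy, hym⟩ := exists_mem_apply_eq hhalf c hm (hu m)
    rw [← hxn, ← hym]
    exact hdist N x hx y hy _
  choose z hz using hlim
  have hev : ∀ c a m, ∀ᶠ n in Filter.atTop, θ (u n fun p => c p) a m = θ (z c) a m := by
    intro c a m
    have hcont : Continuous fun x => θ x a m :=
      (continuous_apply m).comp ((continuous_apply a).comp hθ)
    have := (hcont.tendsto (z c)).comp (hz c)
    rw [nhds_discrete, Filter.tendsto_pure] at this
    exact this
  let code : (ℕ → ℕ → Bool) → ℕ → Bool := fun w n => w (Nat.unpair n).1 (Nat.unpair n).2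
  refine ⟨fun w => z (code w), ?_, fun w w' => ⟨fun h a => ?_, fun h k => ?_⟩⟩
  · refine measurable_of_tendsto_metrizable (f := fun n w => u n fun p => code w p) (fun n => ?_)
      (tendsto_pi_nhds.2 fun w => hz (code w))
    refine (Measurable.of_discrete (f := u n)).comp (measurable_pi_lambda _ fun p => ?_)
    exact (measurable_pi_apply _).comp (measurable_pi_apply _)
  · obtain ⟨N, hN⟩ := exists_forall_ge_eq h (a + 1)
    obtain ⟨n₁, hn₁⟩ := exists_forall_ge_unpair a N
    obtain ⟨M, hM⟩ := htail (max a n₁)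
    refine finite_setOf_ne_iff.2 ⟨M, fun m hm => ?_⟩
    obtain ⟨n, ⟨h1, h2⟩, hn⟩ := (((hev (code w) a m).and (hev (code w') a m)).and
      (Filter.eventually_ge_atTop (max a n₁))).exists
    rw [← h1, ← h2]
    refine tail_eq_of_agree hhalf hhead
      (fun x hx s t => hM x hx s t a (le_max_left _ _)) hn _ (hu n) _ _ (fun p hp hpa => ?_) m hm
    exact hN _ (Nat.lt_succ_of_le hpa) _ (hn₁ p ((le_max_right _ _).trans hp) hpa)
  · obtain ⟨M, hM⟩ := exists_forall_ge_eq h (j k)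
    have hcode' : ∀ c n, θ (z c) (i n) (l n) = xor (v n) (c n) := by
      intro c n
      obtain ⟨m, h1, hm⟩ := ((hev c (i n) (l n)).and
        (Filter.eventually_ge_atTop (n + 1))).exists
      obtain ⟨x, hx, hxm⟩ := exists_mem_apply_eq hhalf c hm (hu m)
      rw [← h1, ← hxm, hcode n x hx]
      simp
    refine finite_setOf_ne_iff.2 ⟨M, fun m hm => ?_⟩
    have hn := hM (i (Nat.pair k m)) (by simpa using hi (Nat.pair k m)) (l (Nat.pair k m))
      (hm.trans ((Nat.right_le_pair k m).trans (hl _)))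
    simpa [hcode', code] using hn

end Fusion

section Stages

variable {X : Type*} [MetricSpace X] [MeasurableSpace X]

/-- The data maintained along the fusion construction: an ideal given by the generators `G` and
a set `C` of configurations that is large for it and on which the positions of the differences
between the points of a configuration are constant in the coordinates below `b`. -/
structure Stage (θ : X → ℕ → ℕ → Bool) (n : ℕ) where
  G : Set (Set X)
  C : Set ((Fin n → Bool) → X)
  j : ℕ → ℕ
  b : ℕ
  M : ℕ
  measurableSet_of_mem : ∀ A ∈ G, MeasurableSet A
  mem_of_good : ∀ B, Good θ B → B ∈ G
  thinSets_subset : ∀ i ≤ n, thinSets θ i (j i) ⊆ G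
  measurableSet_C : MeasurableSet C
  large : Large G C
  E3_of_mem : ∀ x ∈ C, ∀ s t, E3 (θ (x s)) (θ (x t))
  lt_b : n < b
  j_le : ∀ i ≤ n, j i ≤ b
  tail_eq : ∀ x ∈ C, ∀ s t, ∀ i < b, ∀ m ≥ M, θ (x s) i m = θ (x t) i m
  eq_iff_eq : ∀ x ∈ C, ∀ y ∈ C, ∀ s t, ∀ i < b, ∀ m,
    θ (x s) i m = θ (x t) i m ↔ θ (y s) i m = θ (y t) i m
  dist_le : ∀ x ∈ C, ∀ y ∈ C, ∀ s, dist (x s) (y s) ≤ (1 / 2) ^ n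

/-- `S'` is a successor of `S` in the fusion construction, at which the last bit of the index is
coded at the position `(i, l)`. -/
structure Stage.Next {θ : X → ℕ → ℕ → Bool} {n : ℕ} (S : Stage θ n) (S' : Stage θ (n + 1))
    (i l : ℕ) (v : Bool) : Prop where
  half_mem : ∀ x ∈ S'.C, ∀ b, half b x ∈ S.C
  lt_j : i < S.j (Nat.unpair n).1
  le_l : n ≤ l
  code : ∀ x ∈ S'.C, ∀ s, θ (x s) i l = xor v (s (Fin.last n))
  head : ∀ x ∈ S'.C, ∀ s, ∀ a < (Nat.unpair n).1, θ (half false x s) a = θ (half true x s) a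
  j_eq : ∀ a ≤ n, S'.j a = S.j a

variable [SecondCountableTopology X] [BorelSpace X] {θ : X → ℕ → ℕ → Bool}

lemma Large.exists_uniform (hθ : Measurable θ) {G : Set (Set X)} (hG : ∅ ∈ G) {ι : Type*}
    [Finite ι] [Nonempty ι] {C : Set (ι → X)} (hCm : MeasurableSet C) (hC : Large G C)
    (hE : ∀ x ∈ C, ∀ s t, E3 (θ (x s)) (θ (x t))) (b : ℕ) {ε : ℝ} (hε : 0 < ε) :
    ∃ C' ⊆ C, MeasurableSet C' ∧ Large G C' ∧
      (∃ M, ∀ x ∈ C', ∀ s t, ∀ i < b, ∀ m ≥ M, θ (x s) i m = θ (x t) i m) ∧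
      (∀ x ∈ C', ∀ y ∈ C', ∀ s t, ∀ i < b, ∀ m,
        θ (x s) i m = θ (x t) i m ↔ θ (y s) i m = θ (y t) i m) ∧
      ∀ x ∈ C', ∀ y ∈ C', ∀ s, dist (x s) (y s) ≤ ε := by
  obtain ⟨x₀, -⟩ := hC ∅ (Small.of_mem hG)
  have : Nonempty X := ⟨x₀ (Classical.arbitrary ι)⟩
  let D : (ι → ℕ) × (ι × ι × Fin b → Finset ℕ) → Set (ι → X) := fun p =>
    {x | (∀ s, dist (x s) (TopologicalSpace.denseSeq X (p.1 s)) < ε / 2) ∧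
      ∀ q m, θ (x q.1) q.2.2 m = θ (x q.2.1) q.2.2 m ↔ m ∉ p.2 q}
  have hDm : ∀ p, MeasurableSet (D p) := by
    intro p
    refine MeasurableSet.inter
      (s₁ := {x : ι → X | ∀ s, dist (x s) (TopologicalSpace.denseSeq X (p.1 s)) < ε / 2})
      (s₂ := {x : ι → X | ∀ q m, θ (x q.1) q.2.2 m = θ (x q.2.1) q.2.2 m ↔ m ∉ p.2 q}) ?_ ?_
    · rw [Set.ofPred_forall]
      exact .iInter fun s => measurable_pi_apply s measurableSet_ball
    · simp only [Set.ofPred_forall]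
      refine .iInter fun q => .iInter fun m => MeasurableSet.iff ?_ (.const _)
      have hq : Measurable fun x : ι → X => (x q.1, x q.2.1) :=
        (measurable_pi_apply q.1).prodMk (measurable_pi_apply q.2.1)
      exact hq (measurableSet_apply_eq_apply hθ q.2.2 m)
  obtain ⟨p, hp⟩ := hC.exists_inter hG D fun x hx => by
    have h1 : ∀ s, ∃ n, dist (x s) (TopologicalSpace.denseSeq X n) < ε / 2 := fun s => by
      obtain ⟨_, hy, n, rfl⟩ := Metric.dense_iff.1 (TopologicalSpace.denseRange_denseSeq X) (x s)
        (ε / 2) (half_pos hε)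
      exact ⟨n, by rwa [dist_comm]⟩
    choose f hf using h1
    refine Set.mem_iUnion.2 ⟨(f, fun q => (hE x hx q.1 q.2.1 q.2.2).toFinset), hf, fun q m => ?_⟩
    simp
  refine ⟨C ∩ D p, Set.inter_subset_left, hCm.inter (hDm p), hp, ?_, ?_, ?_⟩
  · obtain ⟨M, hM⟩ := (Set.finite_iUnion fun q => (p.2 q).finite_toSet).bddAbove
    refine ⟨M + 1, fun x hx s t i hi m hm => (hx.2.2 (s, t, ⟨i, hi⟩) m).2 fun h => ?_⟩
    have : m ≤ M := hM (Set.mem_iUnion.2 ⟨_, h⟩)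
    omega
  · exact fun x hx y hy s t i hi m =>
      (hx.2.2 (s, t, ⟨i, hi⟩) m).trans (hy.2.2 (s, t, ⟨i, hi⟩) m).symm
  · intro x hx y hy s
    have h1 := hx.2.1 s
    have h2 := hy.2.1 s
    have h3 := dist_triangle_right (x s) (y s) (TopologicalSpace.denseSeq X (p.1 s))
    linarith

variable [CompleteSpace X]

lemma exists_stage (hθ : Measurable θ) {act : Finset (ℕ × ℕ) → X → X}
    (hact : ∀ γ, Measurable (act γ)) (hflip : IsFlip θ act) {n : ℕ} {G : Set (Set X)}
    (hGm : ∀ A ∈ G, MeasurableSet A) (hG : ∀ B, Good θ B → B ∈ G) {j : ℕ → ℕ}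
    (hj : ∀ i < n, thinSets θ i (j i) ⊆ G) {C : Set ((Fin n → Bool) → X)}
    (hCm : MeasurableSet C) (hC : Large G C) (hE : ∀ x ∈ C, ∀ s t, E3 (θ (x s)) (θ (x t))) :
    ∃ S : Stage θ n, S.C ⊆ C ∧ ∀ i < n, S.j i = j i := by
  obtain ⟨jn, hjn⟩ := hC.exists_union_thinSets hθ hact hflip n hG
  let j' := Function.update j n jn
  have hj' : ∀ i < n, j' i = j i := fun i hi => Function.update_of_ne hi.ne _ _
  have hj'n : j' n = jn := Function.update_self _ _ _
  obtain ⟨B, hB⟩ := ((Set.finite_Iic n).image j').bddAbove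
  obtain ⟨C', hC'C, hC'm, hC', ⟨M, hM⟩, hpat, hdist⟩ := hjn.exists_uniform hθ
    (Or.inl (hG _ good_empty)) hCm hE (max (n + 1) B) (ε := (1 / 2) ^ n) (by positivity)
  refine ⟨⟨G ∪ thinSets θ n jn, C', j', max (n + 1) B, M, ?_, fun B h => Or.inl (hG B h), ?_,
    hC'm, hC', fun x hx => hE x (hC'C hx), Nat.lt_of_succ_le (le_max_left _ _), fun i hi => ?_,
    hM, hpat, hdist⟩, hC'C, hj'⟩
  · rintro A (hA | hA)
    exacts [hGm A hA, hA.1]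
  · intro i hi
    rcases hi.lt_or_eq with hi | rfl
    · rw [hj' i hi]
      exact (hj i hi).trans Set.subset_union_left
    · rw [hj'n]
      exact Set.subset_union_right
  · exact (hB ⟨i, hi, rfl⟩).trans (le_max_right _ _)

lemma Stage.exists_next (hθ : Measurable θ) {act : Finset (ℕ × ℕ) → X → X}
    (hact : ∀ γ, Measurable (act γ)) (hflip : IsFlip θ act) {n : ℕ} (S : Stage θ n) :
    ∃ (S' : Stage θ (n + 1)) (i l : ℕ) (v : Bool), S.Next S' i l v := by
  set k := (Nat.unpair n).1 with hk
  have hkn : k ≤ n := Nat.unpair_left_le n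
  let D : ℕ × ℕ × Bool → Set ((Fin (n + 1) → Bool) → X) := fun p =>
    {x | (p.1 < S.j k ∧ max n S.M ≤ p.2.1) ∧ θ (half false x fun _ => false) p.1 p.2.1 = p.2.2 ∧
      θ (half true x fun _ => false) p.1 p.2.1 = !p.2.2}
  have hθx : ∀ (s : Fin (n + 1) → Bool) i m b,
      MeasurableSet {x : (Fin (n + 1) → Bool) → X | θ (x s) i m = b} := fun s i m b =>
    measurableSet_eq_fun ((measurable_pi_apply m).comp ((measurable_pi_apply i).comp
      (hθ.comp (measurable_pi_apply s)))) measurable_const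
  have hDm : ∀ p, MeasurableSet (D p) := fun p =>
    (MeasurableSet.const _).inter ((hθx _ _ _ _).inter (hθx _ _ _ _))
  obtain ⟨⟨i, l, v⟩, hp⟩ := (S.large.joinSet hθ S.measurableSet_of_mem
    (S.thinSets_subset k hkn) (N := max n S.M) S.measurableSet_C).exists_inter
    (S.mem_of_good _ good_empty) D fun x hx => by
      have h := hx.2.2
      push Not at h
      obtain ⟨i, hi, l, hl, hne⟩ := h
      exact Set.mem_iUnion.2 ⟨(i, l, _), ⟨hi, hl⟩, rfl, Bool.eq_not.2 hne.symm⟩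
  obtain ⟨S', hS'C, hS'j⟩ := exists_stage hθ hact hflip S.measurableSet_of_mem S.mem_of_good
    (fun i hi => S.thinSets_subset i (Nat.lt_succ_iff.1 hi))
    ((measurableSet_joinSet hθ k (S.j k) (max n S.M) S.measurableSet_C).inter (hDm (i, l, v))) hp
    (by
      have key : ∀ x ∈ joinSet θ k (S.j k) (max n S.M) S.C, ∀ s,
          E3 (θ (x s)) (θ (half false x fun _ => false)) := by
        intro x hx s
        rw [apply_eq_half x s]
        cases s (Fin.last n) with
        | false => exact S.E3_of_mem _ hx.1.1 _ _
        | true =>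
          exact equivalence_E3.trans (S.E3_of_mem _ hx.1.2 _ _) (equivalence_E3.symm hx.2.1.1)
      exact fun x hx s t => equivalence_E3.trans (key x hx.1 s)
        (equivalence_E3.symm (key x hx.1 t)))
  refine ⟨S', i, l, v, fun x hx b => ?_, ?_, ?_, fun x hx s => ?_, fun x hx s a ha => ?_,
    fun a ha => hS'j a (Nat.lt_succ_of_le ha)⟩
  · cases b
    exacts [(hS'C hx).1.1.1, (hS'C hx).1.1.2]
  · obtain ⟨x, hx, -⟩ := hp ∅ (Small.of_mem (S.mem_of_good _ good_empty))
    exact hx.2.1.1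
  · obtain ⟨x, hx, -⟩ := hp ∅ (Small.of_mem (S.mem_of_good _ good_empty))
    exact (le_max_left _ _).trans hx.2.1.2
  · obtain ⟨⟨⟨hf, ht⟩, -⟩, ⟨hi, hl⟩, h0, h1⟩ := hS'C hx
    have hib : i < S.b := hi.trans_le (S.j_le k hkn)
    have hlM : S.M ≤ l := (le_max_right _ _).trans hl
    rw [apply_eq_half x s]
    cases s (Fin.last n) with
    | false => rw [S.tail_eq _ hf _ (fun _ => false) i hib l hlM, h0, Bool.xor_false]
    | true => rw [S.tail_eq _ ht _ (fun _ => false) i hib l hlM, h1, Bool.xor_true]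
  · obtain ⟨⟨⟨hf, ht⟩, hxy, -⟩, -⟩ := hS'C hx
    funext m
    have h1 := S.eq_iff_eq _ hf _ ht s (fun _ => false) a
      ((ha.trans_le hkn).trans S.lt_b) m
    rw [← hxy.2 a ha] at h1
    revert h1
    cases θ (half false x s) a m <;> cases θ (half true x s) a m <;>
      cases θ (half false x fun _ => false) a m <;> simp

lemma exists_reduction_of_not_good (hθ : Continuous θ) {act : Finset (ℕ × ℕ) → X → X}
    (hact : ∀ γ, Measurable (act γ)) (hflip : IsFlip θ act) (hbad : ¬ Good θ Set.univ) :
    ∃ φ : (ℕ → ℕ → Bool) → X, Measurable φ ∧ ∀ w w', E3 w w' ↔ E3 (θ (φ w)) (θ (φ w')) := by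
  have hlarge : Large {B | Good θ B} (Set.univ : Set ((Fin 0 → Bool) → X)) := by
    rintro Z ⟨A, hA, hZA⟩
    by_contra! hcon
    refine hbad ?_
    convert Good.iUnion hA
    refine (Set.eq_univ_of_forall fun x => ?_).symm
    obtain ⟨s, hs⟩ := hcon (fun _ => x) trivial
    exact hZA hs
  obtain ⟨S₀, -⟩ := exists_stage hθ.measurable hact hflip (n := 0) (j := 0) (fun A hA => hA.1)
    (fun B hB => hB) (fun i hi => (Nat.not_lt_zero i hi).elim) .univ hlarge
    fun x _ s t => Subsingleton.elim s t ▸ equivalence_E3.refl _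
  choose F i l v hF using fun (n : ℕ) (S : Stage θ n) =>
    S.exists_next hθ.measurable hact hflip
  let S : (n : ℕ) → Stage θ n := fun n => Nat.rec S₀ F n
  have hS : ∀ n, (S n).Next (S (n + 1)) (i n (S n)) (l n (S n)) (v n (S n)) := fun n => hF n (S n)
  have hj : ∀ k n, k ≤ n → (S n).j k = (S k).j k := by
    intro k n hkn
    induction n, hkn using Nat.le_induction with
    | base => rfl
    | succ n hkn ih => rw [(hS n).j_eq k hkn, ih]
  refine exists_reduction_of_fusion hθ (C := fun n => (S n).C) (j := fun k => (S k).j k)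
    (fun n => ?_) (fun n => (hS n).half_mem) (fun n => (S n).dist_le) (fun n => ?_)
    (fun n => (hS n).le_l) (fun n => (hS n).code) (fun n => (hS n).head)
    fun n => ⟨(S n).M, fun x hx s t a ha => (S n).tail_eq x hx s t a (ha.trans_lt (S n).lt_b)⟩
  · obtain ⟨x, hx, -⟩ := (S n).large ∅ (Small.of_mem ((S n).mem_of_good _ good_empty))
    exact ⟨x, hx⟩
  · rw [← hj _ n (Nat.unpair_left_le n)]
    exact (hS n).lt_j

end Stages

/-- The dichotomy for a continuous map `θ` admitting an action by finite modifications. -/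
lemma dichotomy_of_isFlip {X : Type*} [TopologicalSpace X] [PolishSpace X] [MeasurableSpace X]
    [BorelSpace X] {θ : X → ℕ → ℕ → Bool} (hθ : Continuous θ) {act : Finset (ℕ × ℕ) → X → X}
    (hact : ∀ γ, Measurable (act γ)) (hflip : IsFlip θ act) :
    (∃ ρ : X → ℕ → Bool, Measurable ρ ∧ ∀ x y, E3 (θ x) (θ y) ↔ E0 (ρ x) (ρ y)) ∨
      ∃ φ : (ℕ → ℕ → Bool) → X, Measurable φ ∧ ∀ w w', E3 w w' ↔ E3 (θ (φ w)) (θ (φ w')) := by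
  by_cases h : Good θ Set.univ
  · obtain ⟨-, -, ρ, hρm, hρ⟩ := h
    exact Or.inl ⟨ρ, hρm, fun x y => hρ x trivial y trivial⟩
  · let := TopologicalSpace.upgradeIsCompletelyMetrizable X
    exact Or.inr (exists_reduction_of_not_good hθ hact hflip h)

/-- The dichotomy for the pullback of `E3` by a continuous map. -/
lemma dichotomy_of_continuous {X : Type*} [TopologicalSpace X] [PolishSpace X]
    [MeasurableSpace X] [BorelSpace X] {θ : X → ℕ → ℕ → Bool} (hθ : Continuous θ) :
    (∃ ρ : X → ℕ → Bool, Measurable ρ ∧ ∀ x y, E3 (θ x) (θ y) ↔ E0 (ρ x) (ρ y)) ∨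
      ∃ φ : (ℕ → ℕ → Bool) → X, Measurable φ ∧ ∀ w w', E3 w w' ↔ E3 (θ (φ w)) (θ (φ w')) := by
  let δ : ℕ ≃ Finset (ℕ × ℕ) := (Denumerable.eqv _).symm
  let θ' : X × ℕ → ℕ → ℕ → Bool := fun p i m => xor (θ p.1 i m) (decide ((i, m) ∈ δ p.2))
  let act : Finset (ℕ × ℕ) → X × ℕ → X × ℕ := fun γ p =>
    (p.1, δ.symm (symmDiff (δ p.2) γ))
  have hθ' : Continuous θ' := by
    refine continuous_pi fun i => continuous_pi fun m => ?_
    have h1 : Continuous fun p : X × ℕ => θ p.1 i m :=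
      (continuous_apply m).comp ((continuous_apply i).comp (hθ.comp continuous_fst))
    have h2 : Continuous fun p : X × ℕ => decide ((i, m) ∈ δ p.2) :=
      (continuous_of_discreteTopology (f := fun n => decide ((i, m) ∈ δ n))).comp continuous_snd
    exact (continuous_of_discreteTopology (f := fun q : Bool × Bool => xor q.1 q.2)).comp
      (h1.prodMk h2)
  have hact : ∀ γ, Measurable (act γ) := fun γ =>
    measurable_fst.prodMk ((Measurable.of_discrete
      (f := fun n => δ.symm (symmDiff (δ n) γ))).comp measurable_snd)
  have hflip : IsFlip θ' act := by
    intro γ x i m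
    simp only [θ', act, Equiv.apply_symm_apply, Finset.mem_symmDiff]
    by_cases h1 : (i, m) ∈ δ x.2 <;>
      by_cases h2 : (i, m) ∈ γ <;> simp [h1, h2]
  have hE : ∀ p, E3 (θ' p) (θ p.1) := by
    refine fun p k => ((δ p.2).finite_toSet.image Prod.snd).subset fun m hm => ?_
    refine ⟨(k, m), ?_, rfl⟩
    by_contra hc
    exact hm (by simp [θ', Finset.mem_coe.not.1 hc])
  have hE' : ∀ p q, E3 (θ' p) (θ' q) ↔ E3 (θ p.1) (θ q.1) := fun p q =>
    ⟨fun h => equivalence_E3.trans (equivalence_E3.symm (hE p)) (equivalence_E3.trans h (hE q)),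
      fun h => equivalence_E3.trans (hE p) (equivalence_E3.trans h (equivalence_E3.symm (hE q)))⟩
  rcases dichotomy_of_isFlip hθ' hact hflip with ⟨ρ, hρm, hρ⟩ | ⟨φ, hφm, hφ⟩
  · exact Or.inl ⟨fun x => ρ (x, 0), hρm.comp (measurable_id.prodMk measurable_const),
      fun x y => (hE' (x, 0) (y, 0)).symm.trans (hρ _ _)⟩
  · exact Or.inr ⟨fun w => (φ w).1, measurable_fst.comp hφm, fun w w' => (hφ w w').trans (hE' _ _)⟩

end SixthDichotomy

/-- Hjorth–Kechris, 6th dichotomy: if a Borel equivalence relation `E`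
on a Polish space is Borel reducible to `E₃`, then either `E ≤B E₀` or `E₃ ≤B E`. -/
theorem sixth_dichotomy
    {X : Type*} [TopologicalSpace X] [PolishSpace X]
    (E : X → X → Prop) (hE : Equivalence E)
    (hBorel : MeasurableSet[borel (X × X)] {p : X × X | E p.1 p.2})
    (hred : BorelReducible E E3) :
    BorelReducible E E0 ∨ BorelReducible E3 E := by
  obtain ⟨θ, hθ, hθE⟩ := hred
  rw [← BorelSpace.measurable_eq (α := ℕ → ℕ → Bool)] at hθ
  have hX : PolishSpace X := inferInstance
  obtain ⟨t', hle, hcont, hpol⟩ := @Measurable.exists_continuous X (ℕ → ℕ → Bool) _ ‹_› (borel X)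
    (@BorelSpace.mk X _ (borel X) rfl) _ _ _ θ _ hθ
  have hb := borel_eq_borel_of_le hpol hX hle
  have hdich := @SixthDichotomy.dichotomy_of_continuous X t' hpol (borel X)
    (@BorelSpace.mk X t' (borel X) rfl) θ hcont
  rcases hdich with ⟨ρ, hρm, hρ⟩ | ⟨φ, hφm, hφ⟩
  · refine Or.inl ⟨ρ, ?_, fun x y => (hθE x y).trans (hρ x y)⟩
    rw [hb] at hρm
    rwa [← BorelSpace.measurable_eq (α := ℕ → Bool)]
  · refine Or.inr ⟨φ, ?_, fun w w' => (hφ w w').trans (hθE _ _).symm⟩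
    rw [hb] at hφm
    rwa [← BorelSpace.measurable_eq (α := ℕ → ℕ → Bool)]
end
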